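/- Let a normal-form feasible schedule of the constructed instance with makespan W be given in which the job processed on machine 2 with start time 0 belongs to B. Then for every i ∈ {0,…,z}: #_{B_i} {λ_2} = 0 (the job λ_2 does not finish before any job of B starts) and #_{B_i} b = #_{B_i} a = #_{B_i} c = #_{B_i} β = #_{B_i} A = #_{B_i} B = i. -/

import Mathlib

/-- Jobs of the instance constructed from a 3-Partition instance with parameter `z`. -/
inductive Job (z : ℕ) : Type
  | JA (i : Fin (z+1))
  | JB (i : Fin (z+1))
  | Ja (i : Fin z)
  | Jb (i : Fin z)
  | Jc (j : Fin (z+1))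
  | Jα (i : Fin z)
  | Jβ (i : Fin z)
  | Jγ (j : Fin z)
  | Jδ (j : Fin z)
  | Jl1
  | Jl2
  | Jpart (i : Fin (3*z))
  deriving DecidableEq, Fintype

/-- Processing times of the constructed jobs (`γ_j`, `δ_j` use index `j ∈ {1,…,z}`,
represented by `j.val + 1` for `j : Fin z`). -/
def pJob (z D : ℕ) (ι : Fin (3*z) → ℕ) : Job z → ℕ
  | .JA _ => D^2
  | .JB _ => D^3
  | .Ja _ => D^4 + D^6 + 3*z*D^7
  | .Jb _ => D^5 + D^6 + 3*z*D^7
  | .Jc j => (z + j.val)*D^7 + D^8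
  | .Jα _ => D^3 + D^5 + 4*z*D^7 + D^8
  | .Jβ _ => D^2 + D^4 + (4*z-1)*D^7 + D^8
  | .Jγ j => D^5 + (3*z - (j.val+1))*D^7 - D
  | .Jδ j => D^4 + (3*z - (j.val+1))*D^7
  | .Jl1 => D^3 + z*D^7 + D^8
  | .Jl2 => D^2 + 2*z*D^7 + D^8
  | .Jpart i => ι i

/-- Machine requirements of the constructed jobs. -/
def qJob (z : ℕ) : Job z → ℕ
  | .JA _ => 3
  | .JB _ => 3
  | .Ja _ => 2
  | .Jb _ => 2
  | .Jc _ => 2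
  | _ => 1

/-- Feasibility of a schedule `(σ, ρ)` on machines `{1,…,m}`: every job gets `q j`
machines among `{1,…,m}`, and jobs sharing a machine have disjoint half-open intervals. -/
def Feasible {J : Type} (m : ℕ) (p q : J → ℕ) (σ : J → ℕ) (ρ : J → Finset ℕ) : Prop :=
  (∀ j, ρ j ⊆ Finset.Icc 1 m) ∧ (∀ j, (ρ j).card = q j) ∧
  (∀ j j', j ≠ j' → (ρ j ∩ ρ j').Nonempty →
    σ j + p j ≤ σ j' ∨ σ j' + p j' ≤ σ j)

/-- Makespan of a schedule. -/
def makespan {J : Type} [Fintype J] (p σ : J → ℕ) : ℕ :=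
  Finset.univ.sup fun j => σ j + p j

/-- The target makespan `W`. -/
def Wval (z D : ℕ) : ℕ :=
  (z+1)*(D^2 + D^3 + D^8) + z*(D^4 + D^5 + D^6) + z*(7*z+1)*D^7

/-- The 3-Partition instance `ι` is a Yes-instance. -/
def IsYes (z D : ℕ) (ι : Fin (3*z) → ℕ) : Prop :=
  ∃ f : Fin (3*z) → Fin z,
    ∀ k : Fin z, ∑ i ∈ Finset.univ.filter (fun i => f i = k), ι i = D

/-- Jobs processed on machine 1 in a normal-form schedule: `A ∪ a ∪ α ∪ {λ₁}`. -/
def M1Jobs {z : ℕ} : Job z → Prop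
  | .JA _ => True
  | .Ja _ => True
  | .Jα _ => True
  | .Jl1 => True
  | _ => False

/-- Jobs processed on machine 4 in a normal-form schedule: `B ∪ b ∪ β ∪ {λ₂}`. -/
def M4Jobs {z : ℕ} : Job z → Prop
  | .JB _ => True
  | .Jb _ => True
  | .Jβ _ => True
  | .Jl2 => True
  | _ => False

/-- Jobs processed on both machines 2 and 3: `A ∪ B ∪ c`. -/
def BothM23 {z : ℕ} : Job z → Prop
  | .JA _ => True
  | .JB _ => True
  | .Jc _ => True
  | _ => False

/-- Jobs processed on exactly one of machines 2 and 3: `a ∪ b ∪ γ ∪ δ ∪ P`. -/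
def OneM23 {z : ℕ} : Job z → Prop
  | .Ja _ => True
  | .Jb _ => True
  | .Jγ _ => True
  | .Jδ _ => True
  | .Jpart _ => True
  | _ => False

/-- Normal form of a schedule of the constructed instance. -/
def NormalForm {z : ℕ} (ρ : Job z → Finset ℕ) : Prop :=
  (∀ j, 1 ∈ ρ j ↔ M1Jobs j) ∧
  (∀ j, 4 ∈ ρ j ↔ M4Jobs j) ∧
  (∀ j, BothM23 j → 2 ∈ ρ j ∧ 3 ∈ ρ j) ∧
  (∀ j, OneM23 j → ((2 ∈ ρ j) ↔ ¬ (3 ∈ ρ j)))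

/-- `cnt p σ S i` = number of jobs of `S` finishing no later than the start of `i`
(the quantity `#ᵢ S`). -/
def cnt {z : ℕ} (p σ : Job z → ℕ) (S : Finset (Job z)) (i : Job z) : ℕ :=
  (S.filter fun j => σ j + p j ≤ σ i).card

def sA (z : ℕ) : Finset (Job z) := Finset.univ.image Job.JA
def sB (z : ℕ) : Finset (Job z) := Finset.univ.image Job.JB
def sa (z : ℕ) : Finset (Job z) := Finset.univ.image Job.Ja
def sb (z : ℕ) : Finset (Job z) := Finset.univ.image Job.Jb
def sc (z : ℕ) : Finset (Job z) := Finset.univ.image Job.Jc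
def sα (z : ℕ) : Finset (Job z) := Finset.univ.image Job.Jα
def sβ (z : ℕ) : Finset (Job z) := Finset.univ.image Job.Jβ
def sγ (z : ℕ) : Finset (Job z) := Finset.univ.image Job.Jγ
def sδ (z : ℕ) : Finset (Job z) := Finset.univ.image Job.Jδ

open Finset in
theorem sum_job {z : ℕ} (f : Job z → ℤ) : ∑ j, f j =
    ∑ i, f (.JA i) + ∑ i, f (.JB i) + ∑ i, f (.Ja i) + ∑ i, f (.Jb i) + ∑ i, f (.Jc i)
    + ∑ i, f (.Jα i) + ∑ i, f (.Jβ i) + ∑ i, f (.Jγ i) + ∑ i, f (.Jδ i) + f .Jl1 + f .Jl2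
    + ∑ i, f (.Jpart i) := by
  let e : (Fin (z+1) ⊕ Fin (z+1) ⊕ Fin z ⊕ Fin z ⊕ Fin (z+1) ⊕ Fin z ⊕ Fin z ⊕ Fin z ⊕ Fin z
      ⊕ Unit ⊕ Unit ⊕ Fin (3*z)) ≃ Job z :=
    { toFun := Sum.elim .JA (Sum.elim .JB (Sum.elim .Ja (Sum.elim .Jb (Sum.elim .Jc (Sum.elim .Jα
        (Sum.elim .Jβ (Sum.elim .Jγ (Sum.elim .Jδ (Sum.elim (fun _ => .Jl1) (Sum.elim (fun _ => .Jl2)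
          .Jpart))))))))))
      invFun := fun j => match j with
        | .JA i => .inl i
        | .JB i => .inr (.inl i)
        | .Ja i => .inr (.inr (.inl i))
        | .Jb i => .inr (.inr (.inr (.inl i)))
        | .Jc i => .inr (.inr (.inr (.inr (.inl i))))
        | .Jα i => .inr (.inr (.inr (.inr (.inr (.inl i)))))
        | .Jβ i => .inr (.inr (.inr (.inr (.inr (.inr (.inl i))))))
        | .Jγ i => .inr (.inr (.inr (.inr (.inr (.inr (.inr (.inl i)))))))
        | .Jδ i => .inr (.inr (.inr (.inr (.inr (.inr (.inr (.inr (.inl i))))))))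
        | .Jl1 => .inr (.inr (.inr (.inr (.inr (.inr (.inr (.inr (.inr (.inl ())))))))))
        | .Jl2 => .inr (.inr (.inr (.inr (.inr (.inr (.inr (.inr (.inr (.inr (.inl ()))))))))))
        | .Jpart i => .inr (.inr (.inr (.inr (.inr (.inr (.inr (.inr (.inr (.inr (.inr i))))))))))
      left_inv := by
        rintro (i | i | i | i | i | i | i | i | i | i | i | i) <;> rfl
      right_inv := by
        intro j; cases j <;> rfl }
  rw [← Fintype.sum_equiv e (fun x => f (e x)) f (fun _ => rfl)]
  simp only [Fintype.sum_sum_type, e, Equiv.coe_fn_mk, Sum.elim_inl, Sum.elim_inr]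
  simp
  ring

theorem pack {J : Type} [DecidableEq J] (S : Finset J) (p σ : J → ℕ) (lo hi : ℕ) (hlh : lo ≤ hi)
    (h1 : ∀ j ∈ S, lo ≤ σ j ∧ σ j + p j ≤ hi)
    (h2 : ∀ j ∈ S, ∀ j' ∈ S, j ≠ j' → σ j + p j ≤ σ j' ∨ σ j' + p j' ≤ σ j) :
    lo + ∑ j ∈ S, p j ≤ hi := by
  have : ∑ j ∈ S, p j = (S.biUnion fun j => Finset.Ico (σ j) (σ j + p j)).card := by
    rw [Finset.card_biUnion]
    · simp
    · intro x hx y hy hxy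
      simp only [Function.onFun]; rw [Finset.disjoint_left]
      intro a ha hb
      simp only [Finset.mem_Ico] at ha hb
      have := h2 x hx y hy hxy
      omega
  have h3 : (S.biUnion fun j => Finset.Ico (σ j) (σ j + p j)) ⊆ Finset.Ico lo hi := by
    intro a ha
    simp only [Finset.mem_biUnion, Finset.mem_Ico] at ha ⊢
    obtain ⟨j, hj, h⟩ := ha
    have := h1 j hj
    omega
  have h4 := Finset.card_le_card h3
  simp at h4
  omega

theorem dig_step (D x y : ℤ) (h : x + D * y = 0) (h1 : -D < x) (h2 : x < D) : x = 0 ∧ y = 0 := by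
  have hD : 0 < D := by linarith
  have hy : y = 0 := by
    by_contra hne
    rcases lt_or_gt_of_ne hne with hy | hy
    · have : y ≤ -1 := by omega
      nlinarith
    · have : 1 ≤ y := by omega
      nlinarith
  subst hy
  simp at h
  exact ⟨h, rfl⟩

theorem digits (D r e2 e3 e4 e5 e6 e7 e8 : ℤ)
    (h : r + e2*D^2 + e3*D^3 + e4*D^4 + e5*D^5 + e6*D^6 + e7*D^7 + e8*D^8 = 0)
    (hr : -D^2 < r ∧ r < D^2) (h2 : -D < e2 ∧ e2 < D) (h3 : -D < e3 ∧ e3 < D)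
    (h4 : -D < e4 ∧ e4 < D) (h5 : -D < e5 ∧ e5 < D) (h6 : -D < e6 ∧ e6 < D)
    (h7 : -D < e7 ∧ e7 < D) :
    r = 0 ∧ e2 = 0 ∧ e3 = 0 ∧ e4 = 0 ∧ e5 = 0 ∧ e6 = 0 ∧ e7 = 0 ∧ e8 = 0 := by
  obtain ⟨a1, b1⟩ := dig_step (D^2) r
    (e2 + D*(e3 + D*(e4 + D*(e5 + D*(e6 + D*(e7 + D * e8)))))) (by linarith) hr.1 hr.2
  obtain ⟨a2, b2⟩ := dig_step D _ _ b1 h2.1 h2.2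
  obtain ⟨a3, b3⟩ := dig_step D _ _ b2 h3.1 h3.2
  obtain ⟨a4, b4⟩ := dig_step D _ _ b3 h4.1 h4.2
  obtain ⟨a5, b5⟩ := dig_step D _ _ b4 h5.1 h5.2
  obtain ⟨a6, b6⟩ := dig_step D _ _ b5 h6.1 h6.2
  obtain ⟨a7, b7⟩ := dig_step D _ _ b6 h7.1 h7.2
  exact ⟨a1, a2, a3, a4, a5, a6, a7, b7⟩

def cN {z n : ℕ} (p σ : Job z → ℕ) (f : Fin n → Job z) (t : ℕ) : ℕ :=
  (Finset.univ.filter fun i => σ (f i) + p (f i) ≤ t).card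
def sN {z n : ℕ} (p σ : Job z → ℕ) (f : Fin n → Job z) (t : ℕ) : ℕ :=
  ∑ i ∈ Finset.univ.filter (fun i => σ (f i) + p (f i) ≤ t), (i.val + 1)
def cM {z n : ℕ} (p σ : Job z → ℕ) (ρ : Job z → Finset ℕ) (f : Fin n → Job z) (x t : ℕ) : ℕ :=
  (Finset.univ.filter fun i => x ∈ ρ (f i) ∧ σ (f i) + p (f i) ≤ t).card
def sM {z n : ℕ} (p σ : Job z → ℕ) (ρ : Job z → Finset ℕ) (f : Fin n → Job z) (x t : ℕ) : ℕ :=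
  ∑ i ∈ Finset.univ.filter (fun i => x ∈ ρ (f i) ∧ σ (f i) + p (f i) ≤ t), (i.val + 1)
def c1 {z : ℕ} (p σ : Job z → ℕ) (j : Job z) (t : ℕ) : ℕ :=
  if σ j + p j ≤ t then 1 else 0
def load {z : ℕ} (p σ : Job z → ℕ) (ρ : Job z → Finset ℕ) (x t : ℕ) : ℕ :=
  ∑ j ∈ Finset.univ.filter (fun j => x ∈ ρ j ∧ σ j + p j ≤ t), p j

theorem load_eq {z : ℕ} (p σ : Job z → ℕ) (ρ : Job z → Finset ℕ) (x W : ℕ)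
    (hpos : ∀ j, 0 < p j)
    (hd : ∀ j j', j ≠ j' → (ρ j ∩ ρ j').Nonempty → σ j + p j ≤ σ j' ∨ σ j' + p j' ≤ σ j)
    (hle : ∀ j, σ j + p j ≤ W) (hW : load p σ ρ x W = W) (e : Job z) (he : x ∈ ρ e) :
    load p σ ρ x (σ e) = σ e := by
  classical
  have hd' : ∀ j, x ∈ ρ j → ∀ j', x ∈ ρ j' → j ≠ j' →
      σ j + p j ≤ σ j' ∨ σ j' + p j' ≤ σ j :=
    fun j h j' h' hne => hd j j' hne ⟨x, Finset.mem_inter.2 ⟨h, h'⟩⟩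
  have h1 := pack (Finset.univ.filter (fun j => x ∈ ρ j ∧ σ j + p j ≤ σ e)) p σ 0 (σ e)
    (Nat.zero_le _) (by simp) (by
      simp only [Finset.mem_filter, Finset.mem_univ, true_and]
      intro j hj j' hj'; exact hd' j hj.1 j' hj'.1)
  have h2 := pack (Finset.univ.filter (fun j => x ∈ ρ j ∧ ¬ σ j + p j ≤ σ e)) p σ (σ e) W
    (le_trans (Nat.le_add_right _ _) (hle e)) (by
      simp only [Finset.mem_filter, Finset.mem_univ, true_and]
      intro j hj
      refine ⟨?_, hle j⟩
      by_cases h : j = e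
      · rw [h]
      · have := hd' j hj.1 e he h
        have := hpos e
        omega) (by
      simp only [Finset.mem_filter, Finset.mem_univ, true_and]
      intro j hj j' hj'; exact hd' j hj.1 j' hj'.1)
  have h3 : load p σ ρ x W = load p σ ρ x (σ e) +
      ∑ j ∈ Finset.univ.filter (fun j => x ∈ ρ j ∧ ¬ σ j + p j ≤ σ e), p j := by
    unfold load
    rw [← Finset.sum_filter_add_sum_filter_not _ (fun j => σ j + p j ≤ σ e)]
    simp only [Finset.filter_filter]
    congr 2
    · ext j; simp only [Finset.mem_filter, Finset.mem_univ, true_and]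
      have := hle j; tauto
    · ext j; simp only [Finset.mem_filter, Finset.mem_univ, true_and]
      have := hle j; tauto
  unfold load at *
  omega

structure Ctx (z D : ℕ) (ι : Fin (3*z) → ℕ) (σ : Job z → ℕ) (ρ : Job z → Finset ℕ) : Prop where
  hz : 0 < z
  hDpos : 0 < D
  hιpos : ∀ i, 0 < ι i
  hsum : ∑ i, ι i = z * D
  hD : 4*z*(7*z+1) < D
  hcard : ∀ j, (ρ j).card = qJob z j
  hd : ∀ j j', j ≠ j' → (ρ j ∩ ρ j').Nonempty →
    σ j + pJob z D ι j ≤ σ j' ∨ σ j' + pJob z D ι j' ≤ σ j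
  hle : ∀ j, σ j + pJob z D ι j ≤ Wval z D
  hnf : NormalForm ρ

section counts
variable {z n : ℕ} (p σ : Job z → ℕ) (ρ : Job z → Finset ℕ) (f : Fin n → Job z)

theorem cM_all (x t : ℕ) (h : ∀ i, x ∈ ρ (f i)) : cM p σ ρ f x t = cN p σ f t := by
  simp [cM, cN, h]
theorem sM_all (x t : ℕ) (h : ∀ i, x ∈ ρ (f i)) : sM p σ ρ f x t = sN p σ f t := by
  simp [sM, sN, h]
theorem cM_none (x t : ℕ) (h : ∀ i, x ∉ ρ (f i)) : cM p σ ρ f x t = 0 := by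
  simp [cM, h]
theorem sM_none (x t : ℕ) (h : ∀ i, x ∉ ρ (f i)) : sM p σ ρ f x t = 0 := by
  simp [sM, h]
theorem split_gen (g : Fin n → ℕ) (t : ℕ) (h : ∀ i, 2 ∈ ρ (f i) ↔ ¬ 3 ∈ ρ (f i)) :
    ∑ i ∈ Finset.univ.filter (fun i => 2 ∈ ρ (f i) ∧ σ (f i) + p (f i) ≤ t), g i +
    ∑ i ∈ Finset.univ.filter (fun i => 3 ∈ ρ (f i) ∧ σ (f i) + p (f i) ≤ t), g i =
    ∑ i ∈ Finset.univ.filter (fun i => σ (f i) + p (f i) ≤ t), g i := by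
  simp only [Finset.sum_filter, ← Finset.sum_add_distrib]
  refine Finset.sum_congr rfl fun i _ => ?_
  have := h i
  by_cases h3 : 3 ∈ ρ (f i) <;> by_cases h2 : 2 ∈ ρ (f i) <;> simp_all
theorem cM_split (t : ℕ) (h : ∀ i, 2 ∈ ρ (f i) ↔ ¬ 3 ∈ ρ (f i)) :
    cM p σ ρ f 2 t + cM p σ ρ f 3 t = cN p σ f t := by
  simp only [cM, cN, Finset.card_eq_sum_ones]
  exact split_gen p σ ρ f (fun _ => 1) t h
theorem sM_split (t : ℕ) (h : ∀ i, 2 ∈ ρ (f i) ↔ ¬ 3 ∈ ρ (f i)) :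
    sM p σ ρ f 2 t + sM p σ ρ f 3 t = sN p σ f t :=
  split_gen p σ ρ f (fun i => i.val + 1) t h
theorem cN_full (W : ℕ) (h : ∀ j, σ j + p j ≤ W) : cN p σ f W = n := by
  simp [cN, h]
theorem sN_full (W : ℕ) (h : ∀ j, σ j + p j ≤ W) : sN p σ f W = ∑ i : Fin n, (i.val + 1) := by
  simp only [sN, h, Finset.filter_true]
theorem cN_le (t : ℕ) : cN p σ f t ≤ n := by
  simpa [cN] using Finset.card_filter_le (Finset.univ : Finset (Fin n)) (fun i => σ (f i) + p (f i) ≤ t)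
theorem cM_le (x t : ℕ) : cM p σ ρ f x t ≤ n := by
  simpa [cM] using Finset.card_filter_le (Finset.univ : Finset (Fin n)) (fun i => x ∈ ρ (f i) ∧ σ (f i) + p (f i) ≤ t)
theorem sM_le (x t : ℕ) : sM p σ ρ f x t ≤ n * cM p σ ρ f x t := by
  rw [mul_comm]
  exact Finset.sum_le_card_nsmul _ _ _ (fun i _ => i.isLt)
theorem sN_le (t : ℕ) : sN p σ f t ≤ n * cN p σ f t := by
  rw [mul_comm]
  exact Finset.sum_le_card_nsmul _ _ _ (fun i _ => i.isLt)
theorem le_sN (t : ℕ) : cN p σ f t ≤ sN p σ f t := by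
  simp only [cN, sN, Finset.card_eq_sum_ones]
  exact Finset.sum_le_sum fun i _ => by omega

theorem fam (x t : ℕ) (u v : ℤ) (h : ∀ i, (p (f i) : ℤ) = u + v * (i.val + 1)) :
    ∑ i, (if x ∈ ρ (f i) ∧ σ (f i) + p (f i) ≤ t then (p (f i) : ℤ) else 0)
     = u * cM p σ ρ f x t + v * sM p σ ρ f x t := by
  simp only [cM, sM, Finset.card_eq_sum_ones]
  push_cast
  rw [Finset.mul_sum, Finset.mul_sum, ← Finset.sum_add_distrib, Finset.sum_filter]
  refine Finset.sum_congr rfl fun i _ => ?_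
  split_ifs
  · rw [h]; ring
  · rfl
end counts

def Pl {z : ℕ} (p σ : Job z → ℕ) (ρ : Job z → Finset ℕ) (x t : ℕ) : ℕ :=
  ∑ i ∈ Finset.univ.filter (fun i => x ∈ ρ (Job.Jpart i) ∧ σ (Job.Jpart i) + p (Job.Jpart i) ≤ t),
    p (Job.Jpart i)

def L1 {z : ℕ} : Fin 1 → Job z := fun _ => .Jl1
def L2 {z : ℕ} : Fin 1 → Job z := fun _ => .Jl2

theorem load_expand {z D : ℕ} {ι : Fin (3*z) → ℕ} {σ : Job z → ℕ} {ρ : Job z → Finset ℕ}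
    (H : Ctx z D ι σ ρ) (x t : ℕ) :
    (load (pJob z D ι) σ ρ x t : ℤ) =
      (cM (pJob z D ι) σ ρ .JA x t : ℤ) * D^2 + (cM (pJob z D ι) σ ρ .JB x t : ℤ) * D^3
      + cM (pJob z D ι) σ ρ .Ja x t * (D^4 + D^6 + 3*z*D^7)
      + cM (pJob z D ι) σ ρ .Jb x t * (D^5 + D^6 + 3*z*D^7)
      + (cM (pJob z D ι) σ ρ .Jc x t * ((z-1)*D^7 + D^8) + sM (pJob z D ι) σ ρ .Jc x t * D^7)
      + cM (pJob z D ι) σ ρ .Jα x t * (D^3 + D^5 + 4*z*D^7 + D^8)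
      + cM (pJob z D ι) σ ρ .Jβ x t * (D^2 + D^4 + (4*z-1)*D^7 + D^8)
      + (cM (pJob z D ι) σ ρ .Jγ x t * (D^5 + 3*z*D^7 - D) - sM (pJob z D ι) σ ρ .Jγ x t * D^7)
      + (cM (pJob z D ι) σ ρ .Jδ x t * (D^4 + 3*z*D^7) - sM (pJob z D ι) σ ρ .Jδ x t * D^7)
      + cM (pJob z D ι) σ ρ L1 x t * (D^3 + z*D^7 + D^8)
      + cM (pJob z D ι) σ ρ L2 x t * (D^2 + 2*z*D^7 + D^8)
      + Pl (pJob z D ι) σ ρ x t := by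
  have hz := H.hz
  have hDD : D ≤ D^5 := Nat.le_self_pow (by norm_num) D
  unfold load
  rw [Finset.sum_filter]
  push_cast
  rw [sum_job]
  rw [fam _ σ ρ .JA x t (D^2) 0 (by intro i; simp [pJob])]
  rw [fam _ σ ρ .JB x t (D^3) 0 (by intro i; simp [pJob])]
  rw [fam _ σ ρ .Ja x t (D^4 + D^6 + 3*z*D^7) 0 (by intro i; simp [pJob])]
  rw [fam _ σ ρ .Jb x t (D^5 + D^6 + 3*z*D^7) 0 (by intro i; simp [pJob])]
  rw [fam _ σ ρ .Jc x t ((z-1)*D^7 + D^8) (D^7) (by intro i; simp [pJob]; ring)]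
  rw [fam _ σ ρ .Jα x t (D^3 + D^5 + 4*z*D^7 + D^8) 0 (by intro i; simp [pJob])]
  rw [fam _ σ ρ .Jβ x t (D^2 + D^4 + (4*z-1)*D^7 + D^8) 0 (by
    intro i; simp only [pJob]; rw [Nat.cast_add, Nat.cast_add, Nat.cast_mul, Nat.cast_sub (by omega)]; push_cast; ring)]
  rw [fam _ σ ρ .Jγ x t (D^5 + 3*z*D^7 - D) (-D^7) (by
    intro i
    have := i.isLt
    simp only [pJob]; rw [Nat.cast_sub (by omega), Nat.cast_add, Nat.cast_mul, Nat.cast_sub (by omega)]; push_cast; ring)]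
  rw [fam _ σ ρ .Jδ x t (D^4 + 3*z*D^7) (-D^7) (by
    intro i
    have := i.isLt
    simp only [pJob]; rw [Nat.cast_add, Nat.cast_mul, Nat.cast_sub (by omega)]; push_cast; ring)]
  have e1 := fam (pJob z D ι) σ ρ L1 x t (D^3 + z*D^7 + D^8) 0 (by intro i; simp [pJob, L1])
  have e2 := fam (pJob z D ι) σ ρ L2 x t (D^2 + 2*z*D^7 + D^8) 0 (by intro i; simp [pJob, L2])
  rw [Fin.sum_univ_one] at e1 e2
  have e1' : (L1 0 : Job z) = .Jl1 := rfl
  have e2' : (L2 0 : Job z) = .Jl2 := rfl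
  rw [e1'] at e1
  rw [e2'] at e2
  rw [e1, e2]
  have e3 : (Pl (pJob z D ι) σ ρ x t : ℤ) = ∑ i, (if x ∈ ρ (.Jpart i) ∧ σ (.Jpart i) + pJob z D ι (.Jpart i) ≤ t then (pJob z D ι (.Jpart i) : ℤ) else 0) := by
    unfold Pl
    rw [Finset.sum_filter]
    push_cast
    rfl
  rw [← e3]
  ring

section facts
variable {z D : ℕ} {ι : Fin (3*z) → ℕ} {σ : Job z → ℕ} {ρ : Job z → Finset ℕ}
  (H : Ctx z D ι σ ρ)
include H

theorem Ctx.hpos (j : Job z) : 0 < pJob z D ι j := by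
  have h0 := H.hDpos
  have hz := H.hz
  have h1 : ∀ k, 0 < D^k := fun k => Nat.pow_pos h0
  have h8 := h1 8
  have h7 := h1 7
  cases j with
  | Jpart i => exact H.hιpos i
  | Jγ i =>
    simp only [pJob]
    have := i.isLt
    have : 1 * D^7 ≤ (3 * z - (↑i + 1)) * D ^ 7 := Nat.mul_le_mul_right _ (by omega)
    have : D ≤ D^5 := Nat.le_self_pow (by norm_num) D
    omega
  | _ => simp only [pJob]; positivity

theorem Ctx.only (x y : ℕ) (j : Job z) (hx : x ∈ ρ j) (hq : qJob z j = 1) (hxy : y ≠ x) : y ∉ ρ j := by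
  have := H.hcard j
  rw [hq, Finset.card_eq_one] at this
  obtain ⟨w, hw⟩ := this
  rw [hw] at hx ⊢
  simp at hx ⊢
  omega

theorem Ctx.load1 (t : ℕ) : (load (pJob z D ι) σ ρ 1 t : ℤ) =
      (cN (pJob z D ι) σ .JA t : ℤ) * D^2
      + cN (pJob z D ι) σ .Ja t * (D^4 + D^6 + 3*z*D^7)
      + cN (pJob z D ι) σ .Jα t * (D^3 + D^5 + 4*z*D^7 + D^8)
      + cN (pJob z D ι) σ L1 t * (D^3 + z*D^7 + D^8) := by
  have h1 := H.hnf.1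
  rw [load_expand H]
  rw [cM_all _ _ _ .JA, cM_none _ _ _ .JB, cM_all _ _ _ .Ja, cM_none _ _ _ .Jb, cM_none _ _ _ .Jc,
    sM_none _ _ _ .Jc, cM_all _ _ _ .Jα, cM_none _ _ _ .Jβ, cM_none _ _ _ .Jγ, sM_none _ _ _ .Jγ,
    cM_none _ _ _ .Jδ, sM_none _ _ _ .Jδ, cM_all _ _ _ L1, cM_none _ _ _ L2]
  · have : Pl (pJob z D ι) σ ρ 1 t = 0 := by
      unfold Pl
      rw [Finset.sum_eq_zero]
      intro i hi
      simp [h1, M1Jobs] at hi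
    rw [this]
    push_cast
    ring
  all_goals intro i; rw [h1]; simp [M1Jobs, L1, L2]

theorem Ctx.load4 (t : ℕ) : (load (pJob z D ι) σ ρ 4 t : ℤ) =
      (cN (pJob z D ι) σ .JB t : ℤ) * D^3
      + cN (pJob z D ι) σ .Jb t * (D^5 + D^6 + 3*z*D^7)
      + cN (pJob z D ι) σ .Jβ t * (D^2 + D^4 + (4*z-1)*D^7 + D^8)
      + cN (pJob z D ι) σ L2 t * (D^2 + 2*z*D^7 + D^8) := by
  have h1 := H.hnf.2.1
  rw [load_expand H]
  rw [cM_all _ _ _ .JB, cM_none _ _ _ .JA, cM_all _ _ _ .Jb, cM_none _ _ _ .Ja, cM_none _ _ _ .Jc,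
    sM_none _ _ _ .Jc, cM_all _ _ _ .Jβ, cM_none _ _ _ .Jα, cM_none _ _ _ .Jγ, sM_none _ _ _ .Jγ,
    cM_none _ _ _ .Jδ, sM_none _ _ _ .Jδ, cM_all _ _ _ L2, cM_none _ _ _ L1]
  · have : Pl (pJob z D ι) σ ρ 4 t = 0 := by
      unfold Pl
      rw [Finset.sum_eq_zero]
      intro i hi
      simp [h1, M4Jobs] at hi
    rw [this]
    push_cast
    ring
  all_goals intro i; rw [h1]; simp [M4Jobs, L1, L2]

theorem Ctx.load23 (x t : ℕ) (hx : x = 2 ∨ x = 3) : (load (pJob z D ι) σ ρ x t : ℤ) =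
      (cN (pJob z D ι) σ .JA t : ℤ) * D^2 + (cN (pJob z D ι) σ .JB t : ℤ) * D^3
      + cM (pJob z D ι) σ ρ .Ja x t * (D^4 + D^6 + 3*z*D^7)
      + cM (pJob z D ι) σ ρ .Jb x t * (D^5 + D^6 + 3*z*D^7)
      + (cN (pJob z D ι) σ .Jc t * ((z-1)*D^7 + D^8) + sN (pJob z D ι) σ .Jc t * D^7)
      + (cM (pJob z D ι) σ ρ .Jγ x t * (D^5 + 3*z*D^7 - D) - sM (pJob z D ι) σ ρ .Jγ x t * D^7)
      + (cM (pJob z D ι) σ ρ .Jδ x t * (D^4 + 3*z*D^7) - sM (pJob z D ι) σ ρ .Jδ x t * D^7)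
      + Pl (pJob z D ι) σ ρ x t := by
  have h1 := H.hnf.2.2.1
  have h11 := H.hnf.1
  have h14 := H.hnf.2.1
  have hb : ∀ j, BothM23 j → x ∈ ρ j := by
    intro j hj
    rcases hx with rfl | rfl
    · exact (h1 j hj).1
    · exact (h1 j hj).2
  rw [load_expand H]
  rw [cM_all _ _ _ .JB, cM_all _ _ _ .JA, cM_all _ _ _ .Jc, sM_all _ _ _ .Jc, cM_none _ _ _ .Jβ,
    cM_none _ _ _ .Jα, cM_none _ _ _ L2, cM_none _ _ _ L1]
  · push_cast
    ring
  · exact fun i => H.only 1 x _ ((h11 _).2 (by simp [M1Jobs, L1])) (by simp [qJob, L1]) (by omega)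
  · exact fun i => H.only 4 x _ ((h14 _).2 (by simp [M4Jobs, L2])) (by simp [qJob, L2]) (by omega)
  · exact fun i => H.only 1 x _ ((h11 _).2 (by simp [M1Jobs])) (by simp [qJob]) (by omega)
  · exact fun i => H.only 4 x _ ((h14 _).2 (by simp [M4Jobs])) (by simp [qJob]) (by omega)
  all_goals intro i; apply hb; simp [BothM23]

theorem Ctx.one (j : Job z) (h : OneM23 j) : (2 ∈ ρ j) ↔ ¬ (3 ∈ ρ j) := H.hnf.2.2.2 j h

theorem Ctx.Pl_split (t : ℕ) : Pl (pJob z D ι) σ ρ 2 t + Pl (pJob z D ι) σ ρ 3 t ≤ z * D := by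
  unfold Pl
  rw [split_gen (pJob z D ι) σ ρ Job.Jpart _ t (fun i => H.one _ (by simp [OneM23])), ← H.hsum]
  exact Finset.sum_le_univ_sum_of_nonneg (fun i => Nat.zero_le _)

theorem Ctx.Pl_split_full : Pl (pJob z D ι) σ ρ 2 (Wval z D) + Pl (pJob z D ι) σ ρ 3 (Wval z D) = z * D := by
  unfold Pl
  rw [split_gen (pJob z D ι) σ ρ Job.Jpart _ _ (fun i => H.one _ (by simp [OneM23])), ← H.hsum]
  simp only [H.hle, Finset.filter_true]
  rfl

theorem Ctx.loadle (x : ℕ) : load (pJob z D ι) σ ρ x (Wval z D) ≤ Wval z D := by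
  have := pack (Finset.univ.filter (fun j => x ∈ ρ j ∧ σ j + pJob z D ι j ≤ Wval z D)) (pJob z D ι) σ
    0 (Wval z D) (Nat.zero_le _) (by simp) (by
      simp only [Finset.mem_filter, Finset.mem_univ, true_and]
      intro j hj j' hj' hne
      exact H.hd j j' hne ⟨x, Finset.mem_inter.2 ⟨hj.1, hj'.1⟩⟩)
  unfold load
  omega

theorem Ctx.loadW (x : ℕ) (hx : x = 1 ∨ x = 2 ∨ x = 3 ∨ x = 4) :
    load (pJob z D ι) σ ρ x (Wval z D) = Wval z D := by
  have hf := H.hle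
  have h23 : load (pJob z D ι) σ ρ 2 (Wval z D) + load (pJob z D ι) σ ρ 3 (Wval z D) = 2 * Wval z D := by
    have e2 := H.load23 2 (Wval z D) (by simp)
    have e3 := H.load23 3 (Wval z D) (by simp)
    have a := cM_split (pJob z D ι) σ ρ .Ja (Wval z D) (fun i => H.one _ (by simp [OneM23]))
    have b := cM_split (pJob z D ι) σ ρ .Jb (Wval z D) (fun i => H.one _ (by simp [OneM23]))
    have c := cM_split (pJob z D ι) σ ρ .Jγ (Wval z D) (fun i => H.one _ (by simp [OneM23]))
    have d := cM_split (pJob z D ι) σ ρ .Jδ (Wval z D) (fun i => H.one _ (by simp [OneM23]))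
    have c' := sM_split (pJob z D ι) σ ρ .Jγ (Wval z D) (fun i => H.one _ (by simp [OneM23]))
    have d' := sM_split (pJob z D ι) σ ρ .Jδ (Wval z D) (fun i => H.one _ (by simp [OneM23]))
    have pp := H.Pl_split_full
    rw [cN_full _ _ _ _ hf] at a b c d
    rw [sN_full _ _ _ _ hf] at c' d'
    rw [cN_full _ _ _ _ hf, cN_full _ _ _ _ hf, cN_full _ _ _ _ hf, sN_full _ _ _ _ hf,
      Fin.sum_univ_castSucc] at e2 e3
    simp only [Fin.val_castSucc, Fin.val_last] at e2 e3
    zify at a b c d c' d' pp ⊢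
    push_cast at e2 e3
    have hWv : ((Wval z D : ℕ) : ℤ) = (z+1)*(D^2 + D^3 + D^8) + z*(D^4 + D^5 + D^6) + z*(7*z+1)*D^7 := by
      unfold Wval; push_cast; ring
    set S : ℤ := ∑ i : Fin z, ((i:ℤ) + 1)
    linear_combination e2 + e3 - 2 * hWv + (D^4 + D^6 + 3*z*D^7 : ℤ) * a + (D^5 + D^6 + 3*z*D^7) * b
      + (D^5 + 3*z*D^7 - D) * c + (D^4 + 3*z*D^7) * d - D^7 * c' - D^7 * d' + pp
  have l2 := H.loadle 2
  have l3 := H.loadle 3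
  rcases hx with rfl | rfl | rfl | rfl
  · zify
    rw [H.load1, cN_full _ _ _ _ hf, cN_full _ _ _ _ hf, cN_full _ _ _ _ hf, cN_full _ _ _ _ hf]
    unfold Wval; push_cast; ring
  · omega
  · omega
  · zify
    rw [H.load4, cN_full _ _ _ _ hf, cN_full _ _ _ _ hf, cN_full _ _ _ _ hf, cN_full _ _ _ _ hf]
    unfold Wval; push_cast; ring

theorem Ctx.sync (x : ℕ) (hx : x = 1 ∨ x = 2 ∨ x = 3 ∨ x = 4) (e : Job z) (he : x ∈ ρ e) :
    load (pJob z D ι) σ ρ x (σ e) = σ e :=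
  load_eq _ _ _ x _ H.hpos H.hd H.hle (H.loadW x hx) e he

end facts

theorem xbounds (z a b g d c sc sg sd : ℤ) (hz : 0 < z) (ha : 0 ≤ a ∧ a ≤ z) (hb : 0 ≤ b ∧ b ≤ z)
    (hg : 0 ≤ g ∧ g ≤ z) (hd : 0 ≤ d ∧ d ≤ z) (hc : 0 ≤ c ∧ c ≤ z + 1)
    (hsc : c ≤ sc ∧ sc ≤ (z+1) * c) (hsg : 0 ≤ sg ∧ sg ≤ z * g) (hsd : 0 ≤ sd ∧ sd ≤ z * d) :
    0 ≤ 3*z*(a+b) + (z-1)*c + sc + 3*z*(g+d) - sg - sd ∧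
    3*z*(a+b) + (z-1)*c + sc + 3*z*(g+d) - sg - sd ≤ 14*z^2 + 2*z := by
  have h1 := mul_nonneg hz.le ha.1
  have h2 := mul_nonneg hz.le hb.1
  have h3 := mul_nonneg hz.le hg.1
  have h4 := mul_nonneg hz.le hd.1
  have h5 := mul_nonneg hz.le hc.1
  have k1 := mul_le_mul_of_nonneg_left ha.2 hz.le
  have k2 := mul_le_mul_of_nonneg_left hb.2 hz.le
  have k3 := mul_le_mul_of_nonneg_left hg.2 hz.le
  have k4 := mul_le_mul_of_nonneg_left hd.2 hz.le
  have k5 := mul_le_mul_of_nonneg_left hc.2 hz.le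
  constructor
  · linarith
  · linarith

section facts
variable {z D : ℕ} {ι : Fin (3*z) → ℕ} {σ : Job z → ℕ} {ρ : Job z → Finset ℕ}
  (H : Ctx z D ι σ ρ)
include H

theorem Ctx.xb (x t : ℕ) :
    let E : ℤ := 3*z*((cM (pJob z D ι) σ ρ .Ja x t : ℤ) + cM (pJob z D ι) σ ρ .Jb x t)
      + (z-1) * cN (pJob z D ι) σ .Jc t + sN (pJob z D ι) σ .Jc t
      + 3*z*(cM (pJob z D ι) σ ρ .Jγ x t + cM (pJob z D ι) σ ρ .Jδ x t)
      - sM (pJob z D ι) σ ρ .Jγ x t - sM (pJob z D ι) σ ρ .Jδ x t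
    0 ≤ E ∧ E ≤ 14*z^2 + 2*z := by
  apply xbounds
  · exact_mod_cast H.hz
  · exact ⟨by positivity, by exact_mod_cast cM_le _ _ _ _ _ _⟩
  · exact ⟨by positivity, by exact_mod_cast cM_le _ _ _ _ _ _⟩
  · exact ⟨by positivity, by exact_mod_cast cM_le _ _ _ _ _ _⟩
  · exact ⟨by positivity, by exact_mod_cast cM_le _ _ _ _ _ _⟩
  · exact ⟨by positivity, by exact_mod_cast cN_le _ _ _ _⟩
  · exact ⟨by exact_mod_cast le_sN _ _ _ _, by exact_mod_cast sN_le _ _ _ _⟩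
  · exact ⟨by positivity, by exact_mod_cast sM_le _ _ _ _ _ _⟩
  · exact ⟨by positivity, by exact_mod_cast sM_le _ _ _ _ _ _⟩

theorem Ctx.Pb (x t : ℕ) (hx : x = 2 ∨ x = 3) : Pl (pJob z D ι) σ ρ x t ≤ z * D := by
  have := H.Pl_split t
  rcases hx with rfl | rfl <;> omega

theorem Ctx.rb (x t : ℕ) (hx : x = 2 ∨ x = 3) :
    -(z * D : ℤ) ≤ (Pl (pJob z D ι) σ ρ x t : ℤ) - cM (pJob z D ι) σ ρ .Jγ x t * D ∧
    (Pl (pJob z D ι) σ ρ x t : ℤ) - cM (pJob z D ι) σ ρ .Jγ x t * D ≤ z * D := by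
  have h1 := H.Pb x t hx
  have h2 := Nat.mul_le_mul_right D (cM_le (pJob z D ι) σ ρ .Jγ x t)
  zify at h1 h2
  constructor
  · have : (0:ℤ) ≤ Pl (pJob z D ι) σ ρ x t := by positivity
    linarith
  · have : (0:ℤ) ≤ cM (pJob z D ι) σ ρ .Jγ x t * D := by positivity
    linarith

theorem Ctx.Dz : (28*z^2 + 4*z : ℤ) < D ∧ (2*(z*D) : ℤ) < D^2 := by
  have h := H.hD
  have h0 := H.hz
  zify at h h0
  have h1 : (28*z^2 + 4*z : ℤ) < D := by linarith
  refine ⟨h1, ?_⟩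
  nlinarith [sq_nonneg (z:ℤ)]

theorem Ctx.SB (e : Job z) (x : ℕ) (hx : x = 2 ∨ x = 3) (h4 : 4 ∈ ρ e) (hxe : x ∈ ρ e) :
    cN (pJob z D ι) σ .JA (σ e) = cN (pJob z D ι) σ .Jc (σ e) ∧
    cN (pJob z D ι) σ .Jc (σ e) = cN (pJob z D ι) σ .Jβ (σ e) + cN (pJob z D ι) σ L2 (σ e) ∧
    cN (pJob z D ι) σ .Jβ (σ e) = cM (pJob z D ι) σ ρ .Ja x (σ e) + cM (pJob z D ι) σ ρ .Jδ x (σ e) ∧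
    cN (pJob z D ι) σ .Jb (σ e) = cM (pJob z D ι) σ ρ .Jb x (σ e) + cM (pJob z D ι) σ ρ .Jγ x (σ e) ∧
    cN (pJob z D ι) σ .Jb (σ e) = cM (pJob z D ι) σ ρ .Ja x (σ e) + cM (pJob z D ι) σ ρ .Jb x (σ e) ∧
    sN (pJob z D ι) σ .Jc (σ e) = sM (pJob z D ι) σ ρ .Jγ x (σ e) + sM (pJob z D ι) σ ρ .Jδ x (σ e)
      + (z+1) * cN (pJob z D ι) σ L2 (σ e) := by
  have s1 := H.sync x (by omega) e hxe
  have s2 := H.sync 4 (by omega) e h4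
  rw [← s2] at s1
  have s3 := congrArg (Nat.cast : ℕ → ℤ) s1
  have e1 := H.load23 x (load (pJob z D ι) σ ρ 4 (σ e)) hx
  rw [s2] at e1
  rw [s2] at s1
  have e4 := H.load4 (σ e)
  rw [s2] at s3 e4
  rw [s3, e4] at e1
  have xb := H.xb x (σ e)
  have rb := H.rb x (σ e) hx
  obtain ⟨d1, d2⟩ := H.Dz
  have hz : (0:ℤ) < z := by exact_mod_cast H.hz
  have bA := cN_le (pJob z D ι) σ .JA (σ e)
  have bβ := cN_le (pJob z D ι) σ .Jβ (σ e)
  have bb := cN_le (pJob z D ι) σ .Jb (σ e)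
  have bl := cN_le (pJob z D ι) σ L2 (σ e)
  have ba := cM_le (pJob z D ι) σ ρ .Ja x (σ e)
  have bbx := cM_le (pJob z D ι) σ ρ .Jb x (σ e)
  have bg := cM_le (pJob z D ι) σ ρ .Jγ x (σ e)
  have bd := cM_le (pJob z D ι) σ ρ .Jδ x (σ e)
  generalize cN (pJob z D ι) σ .JA (σ e) = A at *
  generalize cN (pJob z D ι) σ .JB (σ e) = B at *
  generalize cN (pJob z D ι) σ .Jc (σ e) = c at *
  generalize cN (pJob z D ι) σ .Jβ (σ e) = β at *
  generalize cN (pJob z D ι) σ .Jb (σ e) = b at *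
  generalize cN (pJob z D ι) σ L2 (σ e) = l at *
  generalize cM (pJob z D ι) σ ρ .Ja x (σ e) = ax at *
  generalize cM (pJob z D ι) σ ρ .Jb x (σ e) = bx at *
  generalize cM (pJob z D ι) σ ρ .Jγ x (σ e) = gx at *
  generalize cM (pJob z D ι) σ ρ .Jδ x (σ e) = dx at *
  generalize sN (pJob z D ι) σ .Jc (σ e) = sc at *
  generalize sM (pJob z D ι) σ ρ .Jγ x (σ e) = sg at *
  generalize sM (pJob z D ι) σ ρ .Jδ x (σ e) = sd at *
  generalize Pl (pJob z D ι) σ ρ x (σ e) = P at *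
  clear s1 s2 s3 e4
  zify at *
  have p1 := mul_le_mul_of_nonneg_left bb hz.le
  have p2 := mul_le_mul_of_nonneg_left bβ hz.le
  have p3 := mul_le_mul_of_nonneg_left bl hz.le
  have n1 : (0:ℤ) ≤ z * b := by positivity
  have n2 : (0:ℤ) ≤ z * β := by positivity
  have n3 : (0:ℤ) ≤ z * l := by positivity
  have n4 : (β:ℤ) ≤ z * β := le_mul_of_one_le_left (by positivity) hz
  have n5 : (z:ℤ) ≤ z^2 := by rw [sq]; exact le_mul_of_one_le_left hz.le hz
  have key := digits D (P - gx * D) (A - β - l) 0 (ax + dx - β) (bx + gx - b) (ax + bx - b)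
    ((3*z*(ax+bx) + (z-1)*c + sc + 3*z*(gx+dx) - sg - sd) - (3*z*b + (4*z-1)*β + 2*z*l)) (c - β - l)
    (by linear_combination -e1)
  clear e1
  have nzD : (0:ℤ) ≤ z * D := by positivity
  have := key
    (by constructor <;> linarith) (by constructor <;> linarith) (by constructor <;> linarith)
    (by constructor <;> linarith) (by constructor <;> linarith) (by constructor <;> linarith)
    (by constructor <;> linarith)
  obtain ⟨q1, q2, q3, q4, q5, q6, q7, q8⟩ := this
  refine ⟨by linarith, by linarith, by linarith, by linarith, by linarith, ?_⟩
  linear_combination q7 - 3*z*q6 - 3*z*q4-3*z*q5+3*z*q6-(z-1)*q8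

theorem Ctx.SA (e : Job z) (x : ℕ) (hx : x = 2 ∨ x = 3) (h4 : 1 ∈ ρ e) (hxe : x ∈ ρ e) :
    cN (pJob z D ι) σ .JB (σ e) = cN (pJob z D ι) σ .Jc (σ e) ∧
    cN (pJob z D ι) σ .Jc (σ e) = cN (pJob z D ι) σ .Jα (σ e) + cN (pJob z D ι) σ L1 (σ e) ∧
    cN (pJob z D ι) σ .Ja (σ e) = cM (pJob z D ι) σ ρ .Ja x (σ e) + cM (pJob z D ι) σ ρ .Jδ x (σ e) ∧
    cN (pJob z D ι) σ .Jα (σ e) = cM (pJob z D ι) σ ρ .Jb x (σ e) + cM (pJob z D ι) σ ρ .Jγ x (σ e) ∧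
    cN (pJob z D ι) σ .Ja (σ e) = cM (pJob z D ι) σ ρ .Ja x (σ e) + cM (pJob z D ι) σ ρ .Jb x (σ e) ∧
    sN (pJob z D ι) σ .Jc (σ e) = sM (pJob z D ι) σ ρ .Jγ x (σ e) + sM (pJob z D ι) σ ρ .Jδ x (σ e)
      + cN (pJob z D ι) σ .Jc (σ e) := by
  have s1 := H.sync x (by omega) e hxe
  have s2 := H.sync 1 (by omega) e h4
  rw [← s2] at s1
  have s3 := congrArg (Nat.cast : ℕ → ℤ) s1
  have e1 := H.load23 x (load (pJob z D ι) σ ρ 1 (σ e)) hx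
  rw [s2] at e1
  rw [s2] at s1
  have e4 := H.load1 (σ e)
  rw [s2] at s3 e4
  rw [s3, e4] at e1
  have xb := H.xb x (σ e)
  have rb := H.rb x (σ e) hx
  obtain ⟨d1, d2⟩ := H.Dz
  have hz : (0:ℤ) < z := by exact_mod_cast H.hz
  have bA := cN_le (pJob z D ι) σ .JB (σ e)
  have bβ := cN_le (pJob z D ι) σ .Jα (σ e)
  have bb := cN_le (pJob z D ι) σ .Ja (σ e)
  have bl := cN_le (pJob z D ι) σ L1 (σ e)
  have ba := cM_le (pJob z D ι) σ ρ .Ja x (σ e)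
  have bbx := cM_le (pJob z D ι) σ ρ .Jb x (σ e)
  have bg := cM_le (pJob z D ι) σ ρ .Jγ x (σ e)
  have bd := cM_le (pJob z D ι) σ ρ .Jδ x (σ e)
  generalize cN (pJob z D ι) σ .JA (σ e) = A at *
  generalize cN (pJob z D ι) σ .JB (σ e) = B at *
  generalize cN (pJob z D ι) σ .Jc (σ e) = c at *
  generalize cN (pJob z D ι) σ .Jα (σ e) = α at *
  generalize cN (pJob z D ι) σ .Ja (σ e) = a at *
  generalize cN (pJob z D ι) σ L1 (σ e) = l at *
  generalize cM (pJob z D ι) σ ρ .Ja x (σ e) = ax at *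
  generalize cM (pJob z D ι) σ ρ .Jb x (σ e) = bx at *
  generalize cM (pJob z D ι) σ ρ .Jγ x (σ e) = gx at *
  generalize cM (pJob z D ι) σ ρ .Jδ x (σ e) = dx at *
  generalize sN (pJob z D ι) σ .Jc (σ e) = sc at *
  generalize sM (pJob z D ι) σ ρ .Jγ x (σ e) = sg at *
  generalize sM (pJob z D ι) σ ρ .Jδ x (σ e) = sd at *
  generalize Pl (pJob z D ι) σ ρ x (σ e) = P at *
  clear s1 s2 s3 e4
  zify at *
  have p1 := mul_le_mul_of_nonneg_left bb hz.le
  have p2 := mul_le_mul_of_nonneg_left bβ hz.le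
  have p3 := mul_le_mul_of_nonneg_left bl hz.le
  have n1 : (0:ℤ) ≤ z * a := by positivity
  have n2 : (0:ℤ) ≤ z * α := by positivity
  have n3 : (0:ℤ) ≤ z * l := by positivity
  have n4 : (α:ℤ) ≤ z * α := le_mul_of_one_le_left (by positivity) hz
  have n5 : (z:ℤ) ≤ z^2 := by rw [sq]; exact le_mul_of_one_le_left hz.le hz
  have key := digits D (P - gx * D) 0 (B - α - l) (ax + dx - a) (bx + gx - α) (ax + bx - a)
    ((3*z*(ax+bx) + (z-1)*c + sc + 3*z*(gx+dx) - sg - sd) - (3*z*a + 4*z*α + z*l)) (c - α - l)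
    (by linear_combination -e1)
  clear e1
  have nzD : (0:ℤ) ≤ z * D := by positivity
  have := key
    (by constructor <;> linarith) (by constructor <;> linarith) (by constructor <;> linarith)
    (by constructor <;> linarith) (by constructor <;> linarith) (by constructor <;> linarith)
    (by constructor <;> linarith)
  obtain ⟨q1, q2, q3, q4, q5, q6, q7, q8⟩ := this
  refine ⟨by linarith, by linarith, by linarith, by linarith, by linarith, ?_⟩
  linear_combination q7 - 3*z*q4-3*z*q5-z*q8

theorem Ctx.SC (e : Job z) (h2 : 2 ∈ ρ e) (h3 : 3 ∈ ρ e) :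
    cM (pJob z D ι) σ ρ .Ja 2 (σ e) + cM (pJob z D ι) σ ρ .Jb 2 (σ e) =
    cM (pJob z D ι) σ ρ .Ja 3 (σ e) + cM (pJob z D ι) σ ρ .Jb 3 (σ e) := by
  have s2 := H.sync 2 (by omega) e h2
  have s3 := H.sync 3 (by omega) e h3
  have e2 := H.load23 2 (σ e) (by simp)
  have e3 := H.load23 3 (σ e) (by simp)
  rw [s2] at e2
  rw [s3] at e3
  have xb2 := H.xb 2 (σ e)
  have xb3 := H.xb 3 (σ e)
  have rb2 := H.rb 2 (σ e) (by simp)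
  have rb3 := H.rb 3 (σ e) (by simp)
  obtain ⟨dd1, dd2⟩ := H.Dz
  have hz : (0:ℤ) < z := by exact_mod_cast H.hz
  have k1 := cM_le (pJob z D ι) σ ρ .Ja 2 (σ e)
  have k2 := cM_le (pJob z D ι) σ ρ .Jb 2 (σ e)
  have k3 := cM_le (pJob z D ι) σ ρ .Jγ 2 (σ e)
  have k4 := cM_le (pJob z D ι) σ ρ .Jδ 2 (σ e)
  have k5 := cM_le (pJob z D ι) σ ρ .Ja 3 (σ e)
  have k6 := cM_le (pJob z D ι) σ ρ .Jb 3 (σ e)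
  have k7 := cM_le (pJob z D ι) σ ρ .Jγ 3 (σ e)
  have k8 := cM_le (pJob z D ι) σ ρ .Jδ 3 (σ e)
  generalize cN (pJob z D ι) σ .JA (σ e) = A at *
  generalize cN (pJob z D ι) σ .JB (σ e) = B at *
  generalize cN (pJob z D ι) σ .Jc (σ e) = c at *
  generalize sN (pJob z D ι) σ .Jc (σ e) = sc at *
  generalize cM (pJob z D ι) σ ρ .Ja 2 (σ e) = a2 at *
  generalize cM (pJob z D ι) σ ρ .Jb 2 (σ e) = b2 at *
  generalize cM (pJob z D ι) σ ρ .Jγ 2 (σ e) = g2 at *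
  generalize cM (pJob z D ι) σ ρ .Jδ 2 (σ e) = d2 at *
  generalize cM (pJob z D ι) σ ρ .Ja 3 (σ e) = a3 at *
  generalize cM (pJob z D ι) σ ρ .Jb 3 (σ e) = b3 at *
  generalize cM (pJob z D ι) σ ρ .Jγ 3 (σ e) = g3 at *
  generalize cM (pJob z D ι) σ ρ .Jδ 3 (σ e) = d3 at *
  generalize sM (pJob z D ι) σ ρ .Jγ 2 (σ e) = sg2 at *
  generalize sM (pJob z D ι) σ ρ .Jδ 2 (σ e) = sd2 at *
  generalize sM (pJob z D ι) σ ρ .Jγ 3 (σ e) = sg3 at *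
  generalize sM (pJob z D ι) σ ρ .Jδ 3 (σ e) = sd3 at *
  generalize Pl (pJob z D ι) σ ρ 2 (σ e) = P2 at *
  generalize Pl (pJob z D ι) σ ρ 3 (σ e) = P3 at *
  clear s2 s3
  zify at *
  have n5 : (z:ℤ) ≤ z^2 := by rw [sq]; exact le_mul_of_one_le_left hz.le hz
  have key := digits D ((P2 - g2 * D) - (P3 - g3 * D)) 0 0 (a2 + d2 - a3 - d3) (b2 + g2 - b3 - g3)
    (a2 + b2 - a3 - b3)
    ((3*z*(a2+b2) + (z-1)*c + sc + 3*z*(g2+d2) - sg2 - sd2)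
      - (3*z*(a3+b3) + (z-1)*c + sc + 3*z*(g3+d3) - sg3 - sd3)) 0
    (by linear_combination e3 - e2)
  clear e2 e3
  have nzD : (0:ℤ) ≤ z * D := by positivity
  have := key
    (by constructor <;> linarith) (by constructor <;> linarith) (by constructor <;> linarith)
    (by constructor <;> linarith) (by constructor <;> linarith) (by constructor <;> linarith)
    (by constructor <;> linarith)
  linarith [this.2.2.2.2.2.1]

end facts

section counts2
variable {z n : ℕ} (p σ : Job z → ℕ) (ρ : Job z → Finset ℕ) (f : Fin n → Job z)

theorem cN_mono {s t : ℕ} (h : s ≤ t) : cN p σ f s ≤ cN p σ f t :=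
  Finset.card_le_card (Finset.monotone_filter_right _ (fun _ _ h' => le_trans h' h))
theorem cM_mono (x : ℕ) {s t : ℕ} (h : s ≤ t) : cM p σ ρ f x s ≤ cM p σ ρ f x t :=
  Finset.card_le_card (Finset.monotone_filter_right _ (fun _ _ h' => ⟨h'.1, le_trans h'.2 h⟩))
theorem cN_lt {s t : ℕ} (h : s ≤ t) (k : Fin n) (h1 : s < σ (f k) + p (f k))
    (h2 : σ (f k) + p (f k) ≤ t) : cN p σ f s + 1 ≤ cN p σ f t := by
  apply Finset.card_lt_card
  rw [Finset.ssubset_iff_of_subset (Finset.monotone_filter_right _ (fun _ _ h' => le_trans h' h))]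
  exact ⟨k, by simp [h2], by simp; omega⟩
theorem cM_lt (x : ℕ) {s t : ℕ} (h : s ≤ t) (k : Fin n) (hx : x ∈ ρ (f k))
    (h1 : s < σ (f k) + p (f k))
    (h2 : σ (f k) + p (f k) ≤ t) : cM p σ ρ f x s + 1 ≤ cM p σ ρ f x t := by
  apply Finset.card_lt_card
  rw [Finset.ssubset_iff_of_subset
    (Finset.monotone_filter_right _ (fun _ _ h' => ⟨h'.1, le_trans h'.2 h⟩))]
  exact ⟨k, by simp [h2, hx], by simp [hx]; omega⟩
theorem cN_new {s t : ℕ} (h : cN p σ f s < cN p σ f t) :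
    ∃ k, s < σ (f k) + p (f k) ∧ σ (f k) + p (f k) ≤ t := by
  obtain ⟨k, h1, h2⟩ := Finset.exists_mem_notMem_of_card_lt_card h
  simp at h1 h2
  exact ⟨k, h2, h1⟩
theorem cN_new2 {s t : ℕ} (h : cN p σ f s + 2 ≤ cN p σ f t) (k0 : Fin n) :
    ∃ k, k ≠ k0 ∧ s < σ (f k) + p (f k) ∧ σ (f k) + p (f k) ≤ t := by
  have h' : (insert k0 (Finset.univ.filter fun i => σ (f i) + p (f i) ≤ s)).card
      < (Finset.univ.filter fun i => σ (f i) + p (f i) ≤ t).card := by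
    have := Finset.card_insert_le k0 (Finset.univ.filter fun i => σ (f i) + p (f i) ≤ s)
    unfold cN at h
    omega
  obtain ⟨k, h1, h2⟩ := Finset.exists_mem_notMem_of_card_lt_card h'
  simp at h1 h2
  exact ⟨k, h2.1, h2.2, h1⟩
theorem cM_new (x : ℕ) {s t : ℕ} (h : cM p σ ρ f x s < cM p σ ρ f x t) :
    ∃ k, x ∈ ρ (f k) ∧ s < σ (f k) + p (f k) ∧ σ (f k) + p (f k) ≤ t := by
  obtain ⟨k, h1, h2⟩ := Finset.exists_mem_notMem_of_card_lt_card h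
  simp at h1 h2
  exact ⟨k, h1.1, h2 h1.1, h1.2⟩
theorem cN_first (hp : ∀ j, 0 < p j) (s : ℕ) (h : cN p σ f s < n) :
    ∃ k, s < σ (f k) + p (f k) ∧ cN p σ f (σ (f k)) ≤ cN p σ f s := by
  have hne : (Finset.univ.filter fun k => s < σ (f k) + p (f k)).Nonempty := by
    by_contra hc
    rw [Finset.not_nonempty_iff_eq_empty, Finset.filter_eq_empty_iff] at hc
    have : cN p σ f s = n := by
      unfold cN
      rw [Finset.filter_true_of_mem (fun k hk => not_lt.1 (hc hk))]
      simp
    omega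
  obtain ⟨k, hk, hmin⟩ := Finset.exists_min_image _ (fun k => σ (f k)) hne
  simp at hk hmin
  refine ⟨k, hk, ?_⟩
  by_contra hc
  obtain ⟨k', h1, h2⟩ := cN_new p σ f (not_le.1 hc)
  have := hmin k' h1
  have := hp (f k')
  omega
theorem sN_same {s t : ℕ} (h : s ≤ t) (he : cN p σ f s = cN p σ f t) : sN p σ f s = sN p σ f t := by
  have := Finset.eq_of_subset_of_card_le (Finset.monotone_filter_right (Finset.univ : Finset (Fin n))
    (p := fun i => σ (f i) + p (f i) ≤ s) (q := fun i => σ (f i) + p (f i) ≤ t)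
    (fun _ _ h' => le_trans h' h)) (ge_of_eq he)
  unfold sN
  rw [this]
theorem sM_same (x : ℕ) {s t : ℕ} (h : s ≤ t) (he : cM p σ ρ f x s = cM p σ ρ f x t) :
    sM p σ ρ f x s = sM p σ ρ f x t := by
  have := Finset.eq_of_subset_of_card_le (Finset.monotone_filter_right (Finset.univ : Finset (Fin n))
    (p := fun i => x ∈ ρ (f i) ∧ σ (f i) + p (f i) ≤ s)
    (q := fun i => x ∈ ρ (f i) ∧ σ (f i) + p (f i) ≤ t)
    (fun _ _ h' => ⟨h'.1, le_trans h'.2 h⟩)) (ge_of_eq he)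
  unfold sM
  rw [this]
theorem sM_succ (x : ℕ) {s t : ℕ} (h : s ≤ t) (he : cM p σ ρ f x t = cM p σ ρ f x s + 1) :
    ∃ k : Fin n, x ∈ ρ (f k) ∧ sM p σ ρ f x t = sM p σ ρ f x s + (k.val + 1) := by
  obtain ⟨k, hx, h1, h2⟩ := cM_new p σ ρ f x (s := s) (t := t) (by omega)
  refine ⟨k, hx, ?_⟩
  have hk : k ∉ Finset.univ.filter (fun i => x ∈ ρ (f i) ∧ σ (f i) + p (f i) ≤ s) := by
    simp; omega
  have : insert k (Finset.univ.filter (fun i => x ∈ ρ (f i) ∧ σ (f i) + p (f i) ≤ s)) =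
      Finset.univ.filter (fun i => x ∈ ρ (f i) ∧ σ (f i) + p (f i) ≤ t) := by
    apply Finset.eq_of_subset_of_card_le
    · intro i hi
      simp at hi ⊢
      rcases hi with rfl | hi
      · exact ⟨hx, h2⟩
      · exact ⟨hi.1, le_trans hi.2 h⟩
    · rw [Finset.card_insert_of_notMem hk]
      unfold cM at he
      omega
  unfold sM
  rw [← this, Finset.sum_insert hk]
  ring

theorem noab (m t0 t1 : ℕ) (hinj : Function.Injective f) (hm : ∀ i, m ∈ ρ (f i))
    (hd : ∀ j j', j ≠ j' → (ρ j ∩ ρ j').Nonempty → σ j + p j ≤ σ j' ∨ σ j' + p j' ≤ σ j)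
    (hone : ∀ i, 2 ∈ ρ (f i) ↔ ¬ 3 ∈ ρ (f i)) (ht : t0 ≤ t1)
    (h1 : cM p σ ρ f 2 t1 + cM p σ ρ f 3 t0 = cM p σ ρ f 3 t1 + cM p σ ρ f 2 t0)
    (hx2 : ∀ e, t0 < σ (f e) + p (f e) → σ (f e) + p (f e) ≤ t1 → 2 ∈ ρ (f e) →
      cM p σ ρ f 3 (σ (f e)) = cM p σ ρ f 3 t0)
    (hx3 : ∀ e, t0 < σ (f e) + p (f e) → σ (f e) + p (f e) ≤ t1 → 3 ∈ ρ (f e) →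
      cM p σ ρ f 2 (σ (f e)) = cM p σ ρ f 2 t0) :
    cM p σ ρ f 2 t1 = cM p σ ρ f 2 t0 ∧ cM p σ ρ f 3 t1 = cM p σ ρ f 3 t0 := by
  have m2 := cM_mono p σ ρ f 2 ht
  have m3 := cM_mono p σ ρ f 3 ht
  by_contra hc
  obtain ⟨e, he, he1, he2⟩ := cM_new p σ ρ f 2 (s := t0) (t := t1) (by omega)
  obtain ⟨e', he', he1', he2'⟩ := cM_new p σ ρ f 3 (s := t0) (t := t1) (by omega)
  have hne : e ≠ e' := by
    rintro rfl
    exact (hone e).1 he he'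
  rcases hd (f e) (f e') (fun h => hne (hinj h)) ⟨m, Finset.mem_inter.2 ⟨hm e, hm e'⟩⟩ with h | h
  · have := cM_lt p σ ρ f 2 (s := t0) (t := σ (f e')) (by omega) e he he1 h
    have := hx3 e' he1' he2' he'
    omega
  · have := cM_lt p σ ρ f 3 (s := t0) (t := σ (f e)) (by omega) e' he' he1' h
    have := hx2 e he1 he2 he
    omega
end counts2

section steps
variable {z D : ℕ} {ι : Fin (3*z) → ℕ} {σ : Job z → ℕ} {ρ : Job z → Finset ℕ}
local notation "nn" => cN (pJob z D ι) σ
local notation "xx" => cM (pJob z D ι) σ ρ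

theorem Ctx.mono (_H : Ctx z D ι σ ρ) {s t : ℕ} (h : s ≤ t) :
    nn .JA s ≤ nn .JA t ∧ nn .JB s ≤ nn .JB t ∧ nn .Jc s ≤ nn .Jc t ∧ nn .Ja s ≤ nn .Ja t ∧
    nn .Jb s ≤ nn .Jb t ∧ nn .Jα s ≤ nn .Jα t ∧ nn .Jβ s ≤ nn .Jβ t ∧ nn L1 s ≤ nn L1 t ∧
    nn L2 s ≤ nn L2 t :=
  ⟨cN_mono _ _ _ h, cN_mono _ _ _ h, cN_mono _ _ _ h, cN_mono _ _ _ h, cN_mono _ _ _ h,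
    cN_mono _ _ _ h, cN_mono _ _ _ h, cN_mono _ _ _ h, cN_mono _ _ _ h⟩

theorem Ctx.xmono (_H : Ctx z D ι σ ρ) {s t : ℕ} (h : s ≤ t) (x : ℕ) :
    xx .Ja x s ≤ xx .Ja x t ∧ xx .Jb x s ≤ xx .Jb x t ∧ xx .Jγ x s ≤ xx .Jγ x t ∧
    xx .Jδ x s ≤ xx .Jδ x t :=
  ⟨cM_mono _ _ _ _ _ h, cM_mono _ _ _ _ _ h, cM_mono _ _ _ _ _ h, cM_mono _ _ _ _ _ h⟩

theorem Ctx.spl (H : Ctx z D ι σ ρ) (t : ℕ) :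
    xx .Ja 2 t + xx .Ja 3 t = nn .Ja t ∧ xx .Jb 2 t + xx .Jb 3 t = nn .Jb t :=
  ⟨cM_split _ _ _ _ _ (fun _ => H.one _ trivial), cM_split _ _ _ _ _ (fun _ => H.one _ trivial)⟩

theorem Ctx.sh (H : Ctx z D ι σ ρ) (x : ℕ) {j j' : Job z} (hne : j ≠ j') (hx : x ∈ ρ j)
    (hx' : x ∈ ρ j') : σ j + pJob z D ι j ≤ σ j' ∨ σ j' + pJob z D ι j' ≤ σ j :=
  H.hd j j' hne ⟨x, Finset.mem_inter.2 ⟨hx, hx'⟩⟩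

theorem Ctx.atB (H : Ctx z D ι σ ρ) (k : Fin (z+1)) (x : ℕ) (hx : x = 2 ∨ x = 3) :
    nn .JA (σ (.JB k)) = nn .Jc (σ (.JB k)) ∧
    nn .Jc (σ (.JB k)) = nn .Jβ (σ (.JB k)) + nn L2 (σ (.JB k)) ∧
    nn .Jβ (σ (.JB k)) = xx .Ja x (σ (.JB k)) + xx .Jδ x (σ (.JB k)) ∧
    nn .Jb (σ (.JB k)) = xx .Jb x (σ (.JB k)) + xx .Jγ x (σ (.JB k)) ∧
    nn .Jb (σ (.JB k)) = xx .Ja x (σ (.JB k)) + xx .Jb x (σ (.JB k)) := by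
  have h := H.SB (.JB k) x hx ((H.hnf.2.1 _).2 trivial) (by
    rcases hx with rfl | rfl
    · exact (H.hnf.2.2.1 (.JB k) trivial).1
    · exact (H.hnf.2.2.1 (.JB k) trivial).2)
  exact ⟨h.1, h.2.1, h.2.2.1, h.2.2.2.1, h.2.2.2.2.1⟩

theorem Ctx.atBs (H : Ctx z D ι σ ρ) (k : Fin (z+1)) (x : ℕ) (hx : x = 2 ∨ x = 3) :
    sN (pJob z D ι) σ .Jc (σ (.JB k)) = sM (pJob z D ι) σ ρ .Jγ x (σ (.JB k)) + sM (pJob z D ι) σ ρ .Jδ x (σ (.JB k))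
      + (z+1) * nn L2 (σ (.JB k)) := by
  have h := H.SB (.JB k) x hx ((H.hnf.2.1 _).2 trivial) (by
    rcases hx with rfl | rfl
    · exact (H.hnf.2.2.1 (.JB k) trivial).1
    · exact (H.hnf.2.2.1 (.JB k) trivial).2)
  exact h.2.2.2.2.2

theorem Ctx.atA (H : Ctx z D ι σ ρ) (k : Fin (z+1)) (x : ℕ) (hx : x = 2 ∨ x = 3) :
    nn .JB (σ (.JA k)) = nn .Jc (σ (.JA k)) ∧
    nn .Jc (σ (.JA k)) = nn .Jα (σ (.JA k)) + nn L1 (σ (.JA k)) ∧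
    nn .Ja (σ (.JA k)) = xx .Ja x (σ (.JA k)) + xx .Jδ x (σ (.JA k)) ∧
    nn .Jα (σ (.JA k)) = xx .Jb x (σ (.JA k)) + xx .Jγ x (σ (.JA k)) ∧
    nn .Ja (σ (.JA k)) = xx .Ja x (σ (.JA k)) + xx .Jb x (σ (.JA k)) := by
  have h := H.SA (.JA k) x hx ((H.hnf.1 _).2 trivial) (by
    rcases hx with rfl | rfl
    · exact (H.hnf.2.2.1 (.JA k) trivial).1
    · exact (H.hnf.2.2.1 (.JA k) trivial).2)
  exact ⟨h.1, h.2.1, h.2.2.1, h.2.2.2.1, h.2.2.2.2.1⟩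

theorem Ctx.atAs (H : Ctx z D ι σ ρ) (k : Fin (z+1)) (x : ℕ) (hx : x = 2 ∨ x = 3) :
    sN (pJob z D ι) σ .Jc (σ (.JA k)) = sM (pJob z D ι) σ ρ .Jγ x (σ (.JA k)) + sM (pJob z D ι) σ ρ .Jδ x (σ (.JA k))
      + nn .Jc (σ (.JA k)) := by
  have h := H.SA (.JA k) x hx ((H.hnf.1 _).2 trivial) (by
    rcases hx with rfl | rfl
    · exact (H.hnf.2.2.1 (.JA k) trivial).1
    · exact (H.hnf.2.2.1 (.JA k) trivial).2)
  exact h.2.2.2.2.2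

theorem Ctx.on (H : Ctx z D ι σ ρ) (j : Job z) (h : OneM23 j) : ∃ x, (x = 2 ∨ x = 3) ∧ x ∈ ρ j := by
  by_cases h3 : 3 ∈ ρ j
  · exact ⟨3, by simp, h3⟩
  · exact ⟨2, by simp, (H.one j h).2 h3⟩

theorem Ctx.onC (H : Ctx z D ι σ ρ) (k : Fin (z+1)) (x : ℕ) (hx : x = 2 ∨ x = 3) :
    x ∈ ρ (.JA k) ∧ x ∈ ρ (.JB k) ∧ x ∈ ρ (.Jc k) := by
  have h1 := H.hnf.2.2.1 (.JA k) trivial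
  have h2 := H.hnf.2.2.1 (.JB k) trivial
  have h3 := H.hnf.2.2.1 (.Jc k) trivial
  rcases hx with rfl | rfl <;> simp [h1, h2, h3]


theorem Ctx.abB (H : Ctx z D ι σ ρ) (k : Fin (z+1)) : nn .Ja (σ (.JB k)) = nn .Jb (σ (.JB k)) := by
  obtain ⟨-, -, -, -, h1⟩ := H.atB k 2 (by simp)
  obtain ⟨-, -, -, -, h2⟩ := H.atB k 3 (by simp)
  have := H.spl (σ (.JB k))
  omega

theorem Ctx.abA (H : Ctx z D ι σ ρ) (k : Fin (z+1)) : nn .Ja (σ (.JA k)) = nn .Jb (σ (.JA k)) := by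
  obtain ⟨-, -, -, -, h1⟩ := H.atA k 2 (by simp)
  obtain ⟨-, -, -, -, h2⟩ := H.atA k 3 (by simp)
  have := H.spl (σ (.JA k))
  omega

theorem Ctx.vL (H : Ctx z D ι σ ρ) (i : ℕ) (T L : Fin (z+1)) (hTL : σ (.JB T) ≤ σ (.JB L))
    (hC : nn .Jc (σ (.JB L)) = i) (hb : nn .Jβ (σ (.JB T)) = i) (ha : nn .Ja (σ (.JB T)) = i) :
    nn .JA (σ (.JB L)) = i ∧ nn .Ja (σ (.JB L)) = i ∧ nn .Jb (σ (.JB L)) = i ∧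
      nn .Jβ (σ (.JB L)) = i ∧ nn L2 (σ (.JB L)) = 0 := by
  have hab := H.abB L
  obtain ⟨-, -, a3, -, -⟩ := H.atB T 2 (by simp)
  obtain ⟨-, -, b3, -, -⟩ := H.atB T 3 (by simp)
  obtain ⟨c1, c2, c3, -, -⟩ := H.atB L 2 (by simp)
  obtain ⟨-, -, d3, -, -⟩ := H.atB L 3 (by simp)
  have m1 := cN_mono (pJob z D ι) σ .Jβ hTL
  have h1 : nn .Jβ (σ (.JB L)) = i := by omega
  obtain ⟨m2, -, -, m3⟩ := H.xmono hTL 2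
  obtain ⟨m4, -, -, m5⟩ := H.xmono hTL 3
  obtain ⟨s1, -⟩ := H.spl (σ (.JB L))
  obtain ⟨s2, -⟩ := H.spl (σ (.JB T))
  have h2 : nn .Ja (σ (.JB L)) = i := by omega
  refine ⟨by omega, h2, by omega, h1, by omega⟩

/-- counts of `b` do not change until the next `c`. -/
theorem Ctx.nbC (H : Ctx z D ι σ ρ) (i : ℕ) (L C : Fin (z+1)) (hLC : σ (.JB L) ≤ σ (.Jc C))
    (hC : nn .Jc (σ (.Jc C)) = i) (hβ : nn .Jβ (σ (.JB L)) = i)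
    (ha : nn .Ja (σ (.Jc C)) = nn .Ja (σ (.JB L))) :
    nn .Jb (σ (.Jc C)) = nn .Jb (σ (.JB L)) := by
  have key : ∀ e x, (x = 2 ∨ x = 3) → σ (.JB L) < σ (.Jb e) + pJob z D ι (.Jb e) →
      σ (.Jb e) + pJob z D ι (.Jb e) ≤ σ (.Jc C) → x ∈ ρ (.Jb e) →
      nn .Jb (σ (.Jb e)) = xx .Ja x (σ (.JB L)) + xx .Jb x (σ (.Jb e)) := by
    intro e x hx h1 h2 h3
    obtain ⟨r1, r2, r3, -, r5, -⟩ := H.SB (.Jb e) x hx ((H.hnf.2.1 _).2 trivial) h3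
    have hle : σ (.JB L) ≤ σ (.Jb e) := by
      have := H.sh x (j := .JB L) (j' := .Jb e) (by simp) (H.onC L x hx).2.1 h3
      omega
    have hle2 : σ (.Jb e) ≤ σ (.Jc C) := by omega
    obtain ⟨-, -, b3, -, -⟩ := H.atB L x hx
    have m1 := cN_mono (pJob z D ι) σ .Jc hle2
    have m2 := cN_mono (pJob z D ι) σ .Jβ hle
    obtain ⟨n1, -, -, n2⟩ := H.xmono hle x
    clear hx h1 h2
    omega
  obtain ⟨-, -, -, -, b1⟩ := H.atB L 2 (by simp)
  obtain ⟨-, -, -, -, b2⟩ := H.atB L 3 (by simp)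
  obtain ⟨s1, s2⟩ := H.spl (σ (.JB L))
  obtain ⟨s3, s4⟩ := H.spl (σ (.Jc C))
  obtain ⟨m1, -⟩ := H.xmono hLC 2
  obtain ⟨m2, -⟩ := H.xmono hLC 3
  have hsc := H.SC (.Jc C) (H.onC C 2 (by simp)).2.2 (H.onC C 3 (by simp)).2.2
  have := noab (pJob z D ι) σ ρ .Jb 4 (σ (.JB L)) (σ (.Jc C)) (fun _ _ h => by injection h)
    (fun _ => (H.hnf.2.1 _).2 trivial) H.hd (fun _ => H.one _ trivial) hLC (by omega)
    (by
      intro e h1 h2 h3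
      have k := key e 2 (by simp) h1 h2 h3
      have k2 := (H.spl (σ (.Jb e))).2
      clear h1 h2 s3 s4 m1 m2 hsc
      omega)
    (by
      intro e h1 h2 h3
      have k := key e 3 (by simp) h1 h2 h3
      have k2 := (H.spl (σ (.Jb e))).2
      clear h1 h2 s3 s4 m1 m2 hsc
      omega)
  omega

theorem Ctx.part1 (H : Ctx z D ι σ ρ) (i : ℕ) (hi : i < z) (T : Fin (z+1))
    (hT : nn .JB (σ (.JB T)) = i ∧ nn .JA (σ (.JB T)) = i ∧ nn .Jc (σ (.JB T)) = i ∧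
      nn .Ja (σ (.JB T)) = i ∧ nn .Jb (σ (.JB T)) = i ∧ nn .Jβ (σ (.JB T)) = i ∧
      nn L2 (σ (.JB T)) = 0) :
    ∃ S : Fin (z+1), (∀ k, i + 1 ≤ nn .JB (σ (.JB k)) → i + 1 ≤ nn .Jc (σ (.JB k))) ∧
      nn .JA (σ (.JA S)) = i ∧ nn .Ja (σ (.JA S)) = i ∧ nn .Jb (σ (.JA S)) = i ∧
      nn .Jα (σ (.JA S)) = i ∧ nn L1 (σ (.JA S)) = 1 ∧ nn .JB (σ (.JA S)) = i + 1 ∧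
      nn .Jc (σ (.JA S)) = i + 1 := by
  obtain ⟨L, hL, hmax⟩ := Finset.exists_max_image
    (Finset.univ.filter fun k : Fin (z+1) => nn .Jc (σ (.JB k)) = i) (fun k => σ (.JB k))
    ⟨T, by simp [hT]⟩
  simp only [Finset.mem_filter, Finset.mem_univ, true_and] at hL hmax
  have hTL := hmax T hT.2.2.1
  obtain ⟨v1, v2, v3, v4, v5⟩ := H.vL i T L hTL hL hT.2.2.2.2.2.1 hT.2.2.2.1
  have v6 : i ≤ nn .JB (σ (.JB L)) := by
    rw [← hT.1]
    exact cN_mono _ _ _ hTL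
  clear hT hTL
  -- first c
  obtain ⟨C, hC1, hC2⟩ := cN_first (pJob z D ι) σ .Jc H.hpos (σ (.JB L)) (by omega)
  have pL := H.hpos (.JB L)
  have pC := H.hpos (.Jc C)
  have hLC : σ (.JB L) + pJob z D ι (.JB L) ≤ σ (.Jc C) := by
    have h1 := H.onC L 2 (by simp)
    have h2 := H.onC C 2 (by simp)
    have := H.sh 2 (j := .JB L) (j' := .Jc C) (by simp) h1.2.1 h2.2.2
    omega
  have hLC' : σ (.JB L) ≤ σ (.Jc C) := by omega
  have hCi : nn .Jc (σ (.Jc C)) = i := by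
    have := cN_mono (pJob z D ι) σ .Jc hLC'
    omega
  -- no a finishes in (L,C]
  have naC : nn .Ja (σ (.Jc C)) = i := by
    by_contra hc
    have := cN_mono (pJob z D ι) σ .Ja hLC'
    obtain ⟨k, hk1, hk2⟩ := cN_new (pJob z D ι) σ .Ja (s := σ (.JB L)) (t := σ (.Jc C)) (by omega)
    obtain ⟨x, hx, hxk⟩ := H.on (.Ja k) trivial
    obtain ⟨s, -⟩ := H.SA (.Ja k) x hx ((H.hnf.1 _).2 trivial) hxk
    have h1 := H.onC L x hx
    have hle : σ (.JB L) + pJob z D ι (.JB L) ≤ σ (.Ja k) := by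
      have := H.sh x (j := .JB L) (j' := .Ja k) (by simp) h1.2.1 hxk
      omega
    have m := cN_mono (pJob z D ι) σ .Jc (show σ (.Ja k) ≤ σ (.Jc C) by omega)
    have := cN_lt (pJob z D ι) σ .JB (show σ (.JB L) ≤ σ (.Ja k) by omega) L (by omega) hle
    omega
  have nbC := H.nbC i L C hLC' hCi v4 (by omega)
  -- first A
  obtain ⟨S, hS1, hS2⟩ := cN_first (pJob z D ι) σ .JA H.hpos (σ (.JB L)) (by omega)
  have hLS : σ (.JB L) + pJob z D ι (.JB L) ≤ σ (.JA S) := by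
    have h1 := H.onC L 2 (by simp)
    have h2 := H.onC S 2 (by simp)
    have := H.sh 2 (j := .JB L) (j' := .JA S) (by simp) h1.2.1 h2.1
    omega
  have hLS' : σ (.JB L) ≤ σ (.JA S) := by omega
  have bS : ∀ e, σ (.JB L) < σ (.Jb e) + pJob z D ι (.Jb e) → σ (.JA S) < σ (.Jb e) := by
    intro e he
    obtain ⟨x, hx, hxe⟩ := H.on (.Jb e) trivial
    obtain ⟨s, -⟩ := H.SB (.Jb e) x hx ((H.hnf.2.1 _).2 trivial) hxe
    have hs := H.sh x (j := .Jc C) (j' := .Jb e) (by simp) (H.onC C x hx).2.2 hxe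
    clear hx
    have hCe : σ (.Jc C) + pJob z D ι (.Jc C) ≤ σ (.Jb e) := by
      rcases hs with hs | hs
      · exact hs
      · have := cN_lt (pJob z D ι) σ .Jb hLC' e he hs
        omega
    have := cN_lt (pJob z D ι) σ .Jc (show σ (.JB L) ≤ σ (.Jb e) by omega) C (by omega) hCe
    by_contra hc
    have := cN_mono (pJob z D ι) σ .JA (not_lt.1 hc)
    omega
  obtain ⟨E, hE1, hE2⟩ := cN_first (pJob z D ι) σ .Jb H.hpos (σ (.JB L)) (by omega)
  have hSE := bS E hE1
  obtain ⟨y, hy, hyE⟩ := H.on (.Jb E) trivial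
  have hBS := cN_lt (pJob z D ι) σ .JB hLS' L (by omega) hLS
  clear hC1 hC2 hLC hLC' hCi naC nbC pL pC hE1 hS1 hLS bS
  have hSA : nn .JA (σ (.JA S)) = i := by
    have := cN_mono (pJob z D ι) σ .JA hLS'
    omega
  have m1 := cN_mono (pJob z D ι) σ .Jb hLS'
  have m2 := cN_mono (pJob z D ι) σ .Jb hSE.le
  have hbS : nn .Jb (σ (.JA S)) = i := by omega
  have haS : nn .Ja (σ (.JA S)) = i := by rw [H.abA S, hbS]
  have hl1 : nn L1 (σ (.JA S)) ≤ 1 := cN_le _ _ _ _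
  obtain ⟨a1, a2, a3, a4, a5⟩ := H.atA S y hy
  have hαS : nn .Jα (σ (.JA S)) ≤ i := by
    obtain ⟨e1, e2, e3, e4, e5, -⟩ := H.SB (.Jb E) y hy ((H.hnf.2.1 _).2 trivial) hyE
    obtain ⟨-, n1, n2, -⟩ := H.xmono hSE.le y
    clear hy
    omega
  clear hy
  refine ⟨S, ?_, hSA, haS, hbS, ?_, ?_, ?_, ?_⟩
  · intro k hk
    by_contra hc
    by_cases hkL : σ (.JB k) ≤ σ (.JB L)
    · have := cN_mono (pJob z D ι) σ .JB hkL
      omega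
    · have := cN_mono (pJob z D ι) σ .Jc (not_le.1 hkL).le
      have := hmax k (by omega)
      omega
  all_goals omega
end steps

section steps2
variable {z D : ℕ} {ι : Fin (3*z) → ℕ} {σ : Job z → ℕ} {ρ : Job z → Finset ℕ}
local notation "nn" => cN (pJob z D ι) σ
local notation "xx" => cM (pJob z D ι) σ ρ

theorem Ctx.vA (H : Ctx z D ι σ ρ) (i : ℕ) (S M : Fin (z+1)) (hSM : σ (.JA S) ≤ σ (.JA M))
    (hC : nn .Jc (σ (.JA M)) = i + 1) (hα : nn .Jα (σ (.JA S)) = i) (hl : nn L1 (σ (.JA S)) = 1)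
    (hb : nn .Jb (σ (.JA S)) = i) :
    nn .Jα (σ (.JA M)) = i ∧ nn L1 (σ (.JA M)) = 1 ∧ nn .Ja (σ (.JA M)) = i ∧
      nn .Jb (σ (.JA M)) = i ∧ nn .JB (σ (.JA M)) = i + 1 := by
  have hab := H.abA M
  obtain ⟨-, -, -, a3, -⟩ := H.atA S 2 (by simp)
  obtain ⟨-, -, -, b3, -⟩ := H.atA S 3 (by simp)
  obtain ⟨c1, c2, -, c3, -⟩ := H.atA M 2 (by simp)
  obtain ⟨-, -, -, d3, -⟩ := H.atA M 3 (by simp)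
  have m0 := cN_mono (pJob z D ι) σ L1 hSM
  have hl1 : nn L1 (σ (.JA M)) ≤ 1 := cN_le _ _ _ _
  have h1 : nn .Jα (σ (.JA M)) = i := by omega
  obtain ⟨-, m2, m3, -⟩ := H.xmono hSM 2
  obtain ⟨-, m4, m5, -⟩ := H.xmono hSM 3
  obtain ⟨-, s1⟩ := H.spl (σ (.JA M))
  obtain ⟨-, s2⟩ := H.spl (σ (.JA S))
  have h2 : nn .Jb (σ (.JA M)) = i := by omega
  refine ⟨h1, by omega, by omega, h2, by omega⟩

/-- counts of `a` do not change until the next `c`. -/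
theorem Ctx.naC (H : Ctx z D ι σ ρ) (i : ℕ) (L C : Fin (z+1)) (hLC : σ (.JA L) ≤ σ (.Jc C))
    (hC : nn .Jc (σ (.Jc C)) = i + 1) (hα : nn .Jα (σ (.JA L)) = i) (hl : nn L1 (σ (.JA L)) = 1)
    (ha : nn .Jb (σ (.Jc C)) = nn .Jb (σ (.JA L))) :
    nn .Ja (σ (.Jc C)) = nn .Ja (σ (.JA L)) := by
  have key : ∀ e x, (x = 2 ∨ x = 3) → σ (.JA L) < σ (.Ja e) + pJob z D ι (.Ja e) →
      σ (.Ja e) + pJob z D ι (.Ja e) ≤ σ (.Jc C) → x ∈ ρ (.Ja e) →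
      nn .Ja (σ (.Ja e)) = xx .Ja x (σ (.Ja e)) + xx .Jb x (σ (.JA L)) := by
    intro e x hx h1 h2 h3
    obtain ⟨r1, r2, -, r4, r5, -⟩ := H.SA (.Ja e) x hx ((H.hnf.1 _).2 trivial) h3
    have hle : σ (.JA L) ≤ σ (.Ja e) := by
      have := H.sh x (j := .JA L) (j' := .Ja e) (by simp) (H.onC L x hx).1 h3
      omega
    have hle2 : σ (.Ja e) ≤ σ (.Jc C) := by omega
    obtain ⟨-, -, -, b3, -⟩ := H.atA L x hx
    have m1 := cN_mono (pJob z D ι) σ .Jc hle2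
    have m2 := cN_mono (pJob z D ι) σ .Jα hle
    have m3 := cN_mono (pJob z D ι) σ L1 hle
    obtain ⟨-, n1, n2, -⟩ := H.xmono hle x
    clear hx h1 h2
    omega
  obtain ⟨-, -, -, -, b1⟩ := H.atA L 2 (by simp)
  obtain ⟨-, -, -, -, b2⟩ := H.atA L 3 (by simp)
  obtain ⟨s1, s2⟩ := H.spl (σ (.JA L))
  obtain ⟨s3, s4⟩ := H.spl (σ (.Jc C))
  obtain ⟨-, m1, -⟩ := H.xmono hLC 2
  obtain ⟨-, m2, -⟩ := H.xmono hLC 3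
  have hsc := H.SC (.Jc C) (H.onC C 2 (by simp)).2.2 (H.onC C 3 (by simp)).2.2
  have := noab (pJob z D ι) σ ρ .Ja 1 (σ (.JA L)) (σ (.Jc C)) (fun _ _ h => by injection h)
    (fun _ => (H.hnf.1 _).2 trivial) H.hd (fun _ => H.one _ trivial) hLC (by omega)
    (by
      intro e h1 h2 h3
      have k := key e 2 (by simp) h1 h2 h3
      have k2 := (H.spl (σ (.Ja e))).1
      clear h1 h2 s3 s4 m1 m2 hsc
      omega)
    (by
      intro e h1 h2 h3
      have k := key e 3 (by simp) h1 h2 h3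
      have k2 := (H.spl (σ (.Ja e))).1
      clear h1 h2 s3 s4 m1 m2 hsc
      omega)
  omega

theorem Ctx.part2 (H : Ctx z D ι σ ρ) (i : ℕ) (hi : i < z) (S U : Fin (z+1))
    (hSA : nn .JA (σ (.JA S)) = i) (hSb : nn .Jb (σ (.JA S)) = i) (hSα : nn .Jα (σ (.JA S)) = i)
    (hSl : nn L1 (σ (.JA S)) = 1) (hSC : nn .Jc (σ (.JA S)) = i + 1)
    (hU : nn .JB (σ (.JB U)) = i + 1) (hUC : i + 1 ≤ nn .Jc (σ (.JB U))) :
    nn .Jc (σ (.JB U)) = i + 1 := by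
  obtain ⟨M, hM, hmax⟩ := Finset.exists_max_image
    (Finset.univ.filter fun k : Fin (z+1) => nn .Jc (σ (.JA k)) = i + 1) (fun k => σ (.JA k))
    ⟨S, by simp [hSC]⟩
  simp only [Finset.mem_filter, Finset.mem_univ, true_and] at hM hmax
  have hSM := hmax S hSC
  obtain ⟨v1, v2, v3, v4, v5⟩ := H.vA i S M hSM hM hSα hSl hSb
  have pM := H.hpos (.JA M)
  have hMA : nn .JA (σ (.JA M)) ≤ i := by
    by_contra hc
    have hMA : i + 1 ≤ nn .JA (σ (.JA M)) := by omega
    clear hc hSM hSA hSb hSα hSl hSC hU hUC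
    obtain ⟨C, hC1, hC2⟩ := cN_first (pJob z D ι) σ .Jc H.hpos (σ (.JA M)) (by omega)
    have pC := H.hpos (.Jc C)
    have hLC : σ (.JA M) + pJob z D ι (.JA M) ≤ σ (.Jc C) := by
      have := H.sh 2 (j := .JA M) (j' := .Jc C) (by simp) (H.onC M 2 (by simp)).1
        (H.onC C 2 (by simp)).2.2
      omega
    have hLC' : σ (.JA M) ≤ σ (.Jc C) := by omega
    have hCi : nn .Jc (σ (.Jc C)) = i + 1 := by
      have := cN_mono (pJob z D ι) σ .Jc hLC'
      omega
    have nbC : nn .Jb (σ (.Jc C)) = i := by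
      by_contra hc
      have := cN_mono (pJob z D ι) σ .Jb hLC'
      obtain ⟨k, hk1, hk2⟩ := cN_new (pJob z D ι) σ .Jb (s := σ (.JA M)) (t := σ (.Jc C)) (by omega)
      obtain ⟨x, hx, hxk⟩ := H.on (.Jb k) trivial
      obtain ⟨s, -⟩ := H.SB (.Jb k) x hx ((H.hnf.2.1 _).2 trivial) hxk
      have hle : σ (.JA M) + pJob z D ι (.JA M) ≤ σ (.Jb k) := by
        have := H.sh x (j := .JA M) (j' := .Jb k) (by simp) (H.onC M x hx).1 hxk
        omega
      have m := cN_mono (pJob z D ι) σ .Jc (show σ (.Jb k) ≤ σ (.Jc C) by omega)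
      have := cN_lt (pJob z D ι) σ .JA (show σ (.JA M) ≤ σ (.Jb k) by omega) M (by omega) hle
      omega
    have naC := H.naC i M C hLC' hCi v1 v2 (by omega)
    obtain ⟨E, hE1, hE2⟩ := cN_first (pJob z D ι) σ .Ja H.hpos (σ (.JA M)) (by omega)
    obtain ⟨y, hy, hyE⟩ := H.on (.Ja E) trivial
    obtain ⟨e1, -, e3, -⟩ := H.SA (.Ja E) y hy ((H.hnf.1 _).2 trivial) hyE
    have hCE : σ (.Jc C) + pJob z D ι (.Jc C) ≤ σ (.Ja E) := by
      rcases H.sh y (j := .Jc C) (j' := .Ja E) (by simp) (H.onC C y hy).2.2 hyE with hs | hs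
      · exact hs
      · have := cN_lt (pJob z D ι) σ .Ja hLC' E hE1 hs
        omega
    have hEC := cN_lt (pJob z D ι) σ .Jc (show σ (.JA M) ≤ σ (.Ja E) by omega) C (by omega) hCE
    obtain ⟨B, hB1, hB2⟩ := cN_first (pJob z D ι) σ .JB H.hpos (σ (.JA M)) (by omega)
    have hMB : σ (.JA M) + pJob z D ι (.JA M) ≤ σ (.JB B) := by
      have := H.sh 2 (j := .JA M) (j' := .JB B) (by simp) (H.onC M 2 (by simp)).1
        (H.onC B 2 (by simp)).2.1
      omega
    have hBE : σ (.JB B) ≤ σ (.Ja E) := by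
      by_contra hc
      have := cN_mono (pJob z D ι) σ .JB (not_le.1 hc).le
      omega
    have hBA := cN_lt (pJob z D ι) σ .JA (show σ (.JA M) ≤ σ (.JB B) by omega) M (by omega) hMB
    obtain ⟨b1, b2, b3, -, -⟩ := H.atB B y hy
    obtain ⟨n1, -, -, n2⟩ := H.xmono hBE y
    have hl : nn L2 (σ (.JB B)) ≤ 1 := cN_le _ _ _ _
    clear hy
    omega
  by_contra hc
  obtain ⟨u1, -⟩ := H.atB U 2 (by simp)
  obtain ⟨V, hV0, hV1, hV2⟩ := cN_new2 (pJob z D ι) σ .JA (s := σ (.JA M)) (t := σ (.JB U))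
    (by omega) M
  have hMV : σ (.JA M) + pJob z D ι (.JA M) ≤ σ (.JA V) := by
    have := H.sh 2 (j := .JA M) (j' := .JA V) (fun h => hV0 (by injection h with h; exact h.symm))
      (H.onC M 2 (by simp)).1 (H.onC V 2 (by simp)).1
    omega
  obtain ⟨w1, -⟩ := H.atA V 2 (by simp)
  have m1 := cN_mono (pJob z D ι) σ .Jc (show σ (.JA M) ≤ σ (.JA V) by omega)
  have m2 := cN_mono (pJob z D ι) σ .JB (show σ (.JA V) ≤ σ (.JB U) by omega)
  have := hmax V (by omega)
  omega

set_option maxHeartbeats 1000000 in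
theorem Ctx.part3 (H : Ctx z D ι σ ρ) (i : ℕ) (hi : i < z) (S U : Fin (z+1))
    (hSA : nn .JA (σ (.JA S)) = i) (hSa : nn .Ja (σ (.JA S)) = i)
    (hSb : nn .Jb (σ (.JA S)) = i) (hSα : nn .Jα (σ (.JA S)) = i)
    (hSC : nn .Jc (σ (.JA S)) = i + 1) (hUC : nn .Jc (σ (.JB U)) = i + 1) :
    nn .JA (σ (.JB U)) = i + 1 ∧ nn .Jc (σ (.JB U)) = i + 1 ∧
      nn .Ja (σ (.JB U)) = i + 1 ∧ nn .Jb (σ (.JB U)) = i + 1 ∧ nn .Jβ (σ (.JB U)) = i + 1 ∧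
      nn L2 (σ (.JB U)) = 0 := by
  obtain ⟨u1, u2, p3, p4, p5⟩ := H.atB U 2 (by simp)
  obtain ⟨-, -, q3, q4, q5⟩ := H.atB U 3 (by simp)
  have hab := H.abB U
  have hSU : σ (.JA S) ≤ σ (.JB U) := by
    by_contra hc
    have := cN_mono (pJob z D ι) σ .JA (not_le.1 hc).le
    omega
  have us2 := H.atBs U 2 (by simp)
  have us3 := H.atBs U 3 (by simp)
  have as2 := H.atAs S 2 (by simp)
  have as3 := H.atAs S 3 (by simp)
  have hsN := sN_same (pJob z D ι) σ .Jc hSU (by omega)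
  obtain ⟨-, -, r3, r4, r5⟩ := H.atA S 2 (by simp)
  obtain ⟨-, -, t3, t4, t5⟩ := H.atA S 3 (by simp)
  obtain ⟨ss1, ss2⟩ := H.spl (σ (.JA S))
  obtain ⟨su1, su2⟩ := H.spl (σ (.JB U))
  obtain ⟨m1, m2, m3, m4⟩ := H.xmono hSU 2
  obtain ⟨n1, n2, n3, n4⟩ := H.xmono hSU 3
  have hl : nn L2 (σ (.JB U)) ≤ 1 := cN_le _ _ _ _
  have hl0 : nn L2 (σ (.JB U)) = 0 := by
    by_contra hc
    have hl1 : nn L2 (σ (.JB U)) = 1 := by omega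
    clear as3 us3
    have hβ : nn .Jβ (σ (.JB U)) = i := by
      clear us2 as2 hsN hl hc r5 t5 
      omega
    have g1 : xx .Ja 2 (σ (.JA S)) = xx .Ja 2 (σ (.JB U)) := by
      clear us2 as2 hsN hl hc r5 t5 q3 q4 q5 r4 t3 t4 m2 m3 n1 n2 n3 n4 p4 p5
      omega
    have g2 : xx .Ja 3 (σ (.JA S)) = xx .Ja 3 (σ (.JB U)) := by
      clear us2 as2 hsN hl hc r5 t5 p3 p4 p5 r3 r4 t4 m1 m2 m3 m4 n2 n3 q4 q5
      omega
    have g3 : xx .Jδ 2 (σ (.JA S)) = xx .Jδ 2 (σ (.JB U)) := by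
      clear us2 as2 hsN hl hc r5 t5 q3 q4 q5 r4 t3 t4 m2 m3 n1 n2 n3 n4 p4 p5
      omega
    have g4 : nn .Ja (σ (.JB U)) = i := by
      clear us2 as2 hsN hl hc r5 t5 p3 p4 p5 q3 q4 q5 r3 r4 t3 t4 m1 m2 m3 m4 n1 n2 n3 n4
      omega
    have g5 : xx .Jγ 2 (σ (.JA S)) = xx .Jγ 2 (σ (.JB U)) := by
      clear us2 as2 hsN hl hc r5 t5 p3 q3 r3 t3 m1 m4 n1 n4
      omega
    have e1 := sM_same (pJob z D ι) σ ρ .Jγ 2 hSU g5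
    have e2 := sM_same (pJob z D ι) σ ρ .Jδ 2 hSU g3
    rw [hl1] at us2
    rw [hSC] at as2
    clear g1 g2 g3 g4 g5 m1 m2 m3 m4 n1 n2 n3 n4
    omega
  rw [hl0, Nat.mul_zero] at us2 us3
  rw [hSC] at as2 as3
  have hβ : nn .Jβ (σ (.JB U)) = i + 1 := by omega
  have d1 : xx .Jγ 2 (σ (.JB U)) = xx .Ja 2 (σ (.JB U)) := by linarith only [p4, p5]
  have d2 : xx .Jγ 3 (σ (.JB U)) = xx .Ja 3 (σ (.JB U)) := by linarith only [q4, q5]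
  have d3 : xx .Jγ 2 (σ (.JA S)) = xx .Ja 2 (σ (.JA S)) := by linarith only [r4, r5, hSα, hSa]
  have d4 : xx .Jγ 3 (σ (.JA S)) = xx .Ja 3 (σ (.JA S)) := by linarith only [t4, t5, hSα, hSa]
  have d5 : xx .Ja 2 (σ (.JB U)) + xx .Jδ 2 (σ (.JB U)) = i + 1 := by linarith only [p3, hβ]
  have d6 : xx .Ja 3 (σ (.JB U)) + xx .Jδ 3 (σ (.JB U)) = i + 1 := by linarith only [q3, hβ]
  have d7 : xx .Ja 2 (σ (.JA S)) + xx .Jδ 2 (σ (.JA S)) = i := by linarith only [r3, hSa]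
  have d8 : xx .Ja 3 (σ (.JA S)) + xx .Jδ 3 (σ (.JA S)) = i := by linarith only [t3, hSa]
  have hb' : nn .Jb (σ (.JB U)) = nn .Ja (σ (.JB U)) := hab.symm
  have hA' : nn .JA (σ (.JB U)) = i + 1 := u1.trans hUC
  have hs2 : sM (pJob z D ι) σ ρ .Jγ 2 (σ (.JB U)) + sM (pJob z D ι) σ ρ .Jδ 2 (σ (.JB U)) =
      sM (pJob z D ι) σ ρ .Jγ 2 (σ (.JA S)) + sM (pJob z D ι) σ ρ .Jδ 2 (σ (.JA S)) + (i + 1) := by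
    omega
  have hs3 : sM (pJob z D ι) σ ρ .Jγ 3 (σ (.JB U)) + sM (pJob z D ι) σ ρ .Jδ 3 (σ (.JB U)) =
      sM (pJob z D ι) σ ρ .Jγ 3 (σ (.JA S)) + sM (pJob z D ι) σ ρ .Jδ 3 (σ (.JA S)) + (i + 1) := by
    omega
  clear us2 us3 as2 as3 hsN p3 p4 p5 q3 q4 q5 r3 r4 r5 t3 t4 t5 u1 u2 hab ss2 su2 hSA hSb hSα hl
  have ha : nn .Ja (σ (.JB U)) = i + 1 := by
    by_contra hc
    have h02 : nn .Ja (σ (.JB U)) = i ∨ nn .Ja (σ (.JB U)) = i + 2 := by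
      clear m2 m3 n2 n3 d1 d2 d3 d4
      omega
    rcases h02 with h | h
    · have g1 : xx .Jδ 2 (σ (.JB U)) = xx .Jδ 2 (σ (.JA S)) + 1 := by
        clear m2 m3 n2 n3 hs2 hs3 hc
        omega
      have g2 : xx .Jδ 3 (σ (.JB U)) = xx .Jδ 3 (σ (.JA S)) + 1 := by
        clear m2 m3 n2 n3 hs2 hs3 hc
        omega
      have g3 : xx .Jγ 2 (σ (.JA S)) = xx .Jγ 2 (σ (.JB U)) := by
        clear m2 m3 n2 n3 hs2 hs3 hc
        omega
      have g4 : xx .Jγ 3 (σ (.JA S)) = xx .Jγ 3 (σ (.JB U)) := by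
        clear m2 m3 n2 n3 hs2 hs3 hc
        omega
      have e1 := sM_same (pJob z D ι) σ ρ .Jγ 2 hSU g3
      have e2 := sM_same (pJob z D ι) σ ρ .Jγ 3 hSU g4
      obtain ⟨k, hk, f1⟩ := sM_succ (pJob z D ι) σ ρ .Jδ 2 hSU g1
      obtain ⟨k', hk', f2⟩ := sM_succ (pJob z D ι) σ ρ .Jδ 3 hSU g2
      have : k = k' := by
        apply Fin.ext
        clear m1 m2 m3 m4 n1 n2 n3 n4 ss1 su1 g1 g2 g3 g4 d1 d2 d3 d4 d5 d6 d7 d8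
        omega
      subst this
      exact (H.one (.Jδ k) trivial).1 hk hk'
    · have g1 : xx .Jγ 2 (σ (.JB U)) = xx .Jγ 2 (σ (.JA S)) + 1 := by
        clear m2 m3 n2 n3 hs2 hs3 hc
        omega
      have g2 : xx .Jγ 3 (σ (.JB U)) = xx .Jγ 3 (σ (.JA S)) + 1 := by
        clear m2 m3 n2 n3 hs2 hs3 hc
        omega
      have g3 : xx .Jδ 2 (σ (.JA S)) = xx .Jδ 2 (σ (.JB U)) := by
        clear m2 m3 n2 n3 hs2 hs3 hc
        omega
      have g4 : xx .Jδ 3 (σ (.JA S)) = xx .Jδ 3 (σ (.JB U)) := by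
        clear m2 m3 n2 n3 hs2 hs3 hc
        omega
      have e1 := sM_same (pJob z D ι) σ ρ .Jδ 2 hSU g3
      have e2 := sM_same (pJob z D ι) σ ρ .Jδ 3 hSU g4
      obtain ⟨k, hk, f1⟩ := sM_succ (pJob z D ι) σ ρ .Jγ 2 hSU g1
      obtain ⟨k', hk', f2⟩ := sM_succ (pJob z D ι) σ ρ .Jγ 3 hSU g2
      have : k = k' := by
        apply Fin.ext
        clear m1 m2 m3 m4 n1 n2 n3 n4 ss1 su1 g1 g2 g3 g4 d1 d2 d3 d4 d5 d6 d7 d8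
        omega
      subst this
      exact (H.one (.Jγ k) trivial).1 hk hk'
  exact ⟨hA', hUC, ha, hb'.trans ha, hβ, hl0⟩

theorem Ctx.step (H : Ctx z D ι σ ρ) (i : ℕ) (hi : i < z) (T U : Fin (z+1))
    (hT : nn .JB (σ (.JB T)) = i ∧ nn .JA (σ (.JB T)) = i ∧ nn .Jc (σ (.JB T)) = i ∧
      nn .Ja (σ (.JB T)) = i ∧ nn .Jb (σ (.JB T)) = i ∧ nn .Jβ (σ (.JB T)) = i ∧
      nn L2 (σ (.JB T)) = 0) (hU : nn .JB (σ (.JB U)) = i + 1) :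
    nn .JB (σ (.JB U)) = i + 1 ∧ nn .JA (σ (.JB U)) = i + 1 ∧ nn .Jc (σ (.JB U)) = i + 1 ∧
      nn .Ja (σ (.JB U)) = i + 1 ∧ nn .Jb (σ (.JB U)) = i + 1 ∧ nn .Jβ (σ (.JB U)) = i + 1 ∧
      nn L2 (σ (.JB U)) = 0 := by
  obtain ⟨S, h0, h1, h2, h3, h4, h5, h6, h7⟩ := H.part1 i hi T hT
  have hC := H.part2 i hi S U h1 h3 h4 h5 h7 hU (h0 U hU.ge)
  exact ⟨hU, H.part3 i hi S U h1 h2 h3 h4 h7 hC⟩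
end steps2

theorem cnt_image {z n : ℕ} (p σ : Job z → ℕ) (f : Fin n → Job z) (hf : Function.Injective f)
    (j : Job z) : cnt p σ (Finset.univ.image f) j = cN p σ f (σ j) := by
  unfold cnt cN
  rw [Finset.filter_image, Finset.card_image_of_injective _ hf]

/-- If the job starting at time 0 on machine 2 is in `B`, then for every
`i ∈ {0,…,z}`: `λ₂` does not finish before `Bᵢ` starts, and
`#_{Bᵢ} b = #_{Bᵢ} a = #_{Bᵢ} c = #_{Bᵢ} β = #_{Bᵢ} A = #_{Bᵢ} B = i`. -/
theorem counts_at_Bi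
    (z D : ℕ) (ι : Fin (3*z) → ℕ)
    (hz : 0 < z) (hDpos : 0 < D)
    (hιpos : ∀ i, 0 < ι i)
    (hsum : ∑ i, ι i = z * D)
    (hlow : ∀ i, D < 4 * ι i)
    (hhigh : ∀ i, 2 * ι i < D)
    (hD : 4*z*(7*z+1) < D)
    (σ : Job z → ℕ) (ρ : Job z → Finset ℕ)
    (hfeas : Feasible 4 (pJob z D ι) (qJob z) σ ρ)
    (hmk : makespan (pJob z D ι) σ = Wval z D)
    (hnf : NormalForm ρ)
    (Benum : Fin (z+1) → Job z)
    (hBmem : ∀ i, Benum i ∈ sB z)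
    (hBinj : Function.Injective Benum)
    (hBmono : Monotone fun i => σ (Benum i))
    (hfirst : ∃ j ∈ sB z, 2 ∈ ρ j ∧ σ j = 0) :
    ∀ i : Fin (z+1),
      cnt (pJob z D ι) σ {Job.Jl2} (Benum i) = 0 ∧
      cnt (pJob z D ι) σ (sb z) (Benum i) = i.val ∧
      cnt (pJob z D ι) σ (sa z) (Benum i) = i.val ∧
      cnt (pJob z D ι) σ (sc z) (Benum i) = i.val ∧
      cnt (pJob z D ι) σ (sβ z) (Benum i) = i.val ∧
      cnt (pJob z D ι) σ (sA z) (Benum i) = i.val ∧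
      cnt (pJob z D ι) σ (sB z) (Benum i) = i.val := by
  have H : Ctx z D ι σ ρ :=
    ⟨hz, hDpos, hιpos, hsum, hD, hfeas.2.1, hfeas.2.2,
      fun j => hmk ▸ Finset.le_sup (f := fun j => σ j + pJob z D ι j) (Finset.mem_univ j), hnf⟩
  have hex : ∀ i, ∃ k, Job.JB k = Benum i := fun i => by simpa [sB] using hBmem i
  choose g hg using hex
  have hginj : Function.Injective g := fun a b h => hBinj (by rw [← hg a, ← hg b, h])
  have hgs : Function.Surjective g := (Finite.injective_iff_surjective).1 hginj
  have hmono : ∀ a b : Fin (z+1), a ≤ b → σ (.JB (g a)) ≤ σ (.JB (g b)) := by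
    intro a b h
    rw [hg, hg]
    exact hBmono h
  have hstr : ∀ a b : Fin (z+1), σ (.JB (g a)) + pJob z D ι (.JB (g a)) ≤ σ (.JB (g b)) ↔ a < b := by
    intro a b
    have p1 := H.hpos (.JB (g a))
    have p2 := H.hpos (.JB (g b))
    constructor
    · intro h
      by_contra hc
      have := hmono b a (not_lt.1 hc)
      omega
    · intro h
      have h1 := hmono a b h.le
      have := H.sh 2 (j := .JB (g a)) (j' := .JB (g b))
        (fun e => h.ne (hginj (by injection e))) (H.onC _ 2 (by simp)).2.1 (H.onC _ 2 (by simp)).2.1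
      omega
  have hB : ∀ i, cN (pJob z D ι) σ .JB (σ (.JB (g i))) = i.val := by
    intro i
    have : (Finset.univ.filter fun k => σ (Job.JB k) + pJob z D ι (.JB k) ≤ σ (.JB (g i)))
        = (Finset.Iio i).image g := by
      ext k
      obtain ⟨a, rfl⟩ := hgs k
      simp only [Finset.mem_filter, Finset.mem_univ, true_and, Finset.mem_image, Finset.mem_Iio]
      rw [hstr]
      exact ⟨fun h => ⟨a, h, rfl⟩, fun ⟨b, hb, e⟩ => hginj e ▸ hb⟩
    unfold cN
    rw [this, Finset.card_image_of_injective _ hginj, Fin.card_Iio]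
  have h0 : σ (.JB (g 0)) = 0 := by
    obtain ⟨j, hj, -, hj0⟩ := hfirst
    simp only [sB, Finset.mem_image, Finset.mem_univ, true_and] at hj
    obtain ⟨k, rfl⟩ := hj
    obtain ⟨a, rfl⟩ := hgs k
    have := hmono 0 a (Fin.zero_le a)
    omega
  have hz0 : ∀ {n : ℕ} (f : Fin n → Job z), cN (pJob z D ι) σ f (σ (.JB (g 0))) = 0 := by
    intro n f
    rw [h0]
    unfold cN
    rw [Finset.card_eq_zero, Finset.filter_eq_empty_iff]
    intro k _
    have := H.hpos (f k)
    omega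
  have main : ∀ m (hm : m < z + 1),
      cN (pJob z D ι) σ .JB (σ (.JB (g ⟨m, hm⟩))) = m ∧ cN (pJob z D ι) σ .JA (σ (.JB (g ⟨m, hm⟩))) = m ∧
      cN (pJob z D ι) σ .Jc (σ (.JB (g ⟨m, hm⟩))) = m ∧ cN (pJob z D ι) σ .Ja (σ (.JB (g ⟨m, hm⟩))) = m ∧
      cN (pJob z D ι) σ .Jb (σ (.JB (g ⟨m, hm⟩))) = m ∧ cN (pJob z D ι) σ .Jβ (σ (.JB (g ⟨m, hm⟩))) = m ∧
      cN (pJob z D ι) σ L2 (σ (.JB (g ⟨m, hm⟩))) = 0 := by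
    intro m
    induction m with
    | zero =>
      intro hm
      exact ⟨hz0 _, hz0 _, hz0 _, hz0 _, hz0 _, hz0 _, hz0 _⟩
    | succ m ih =>
      intro hm
      exact H.step m (by omega) (g ⟨m, by omega⟩) (g ⟨m + 1, hm⟩) (ih (by omega)) (hB ⟨m + 1, hm⟩)
  intro i
  obtain ⟨h1, h2, h3, h4, h5, h6, h7⟩ := main i.val i.isLt
  rw [hg] at h1 h2 h3 h4 h5 h6 h7
  have hl : ({Job.Jl2} : Finset (Job z)) = Finset.univ.image L2 := by
    ext j
    simp [L2, eq_comm]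
  refine ⟨?_, ?_, ?_, ?_, ?_, ?_, ?_⟩
  · rw [hl, cnt_image _ _ _ (fun _ _ _ => Subsingleton.elim _ _)]
    exact h7
  all_goals first | unfold sb | unfold sa | unfold sc | unfold sβ | unfold sA | unfold sB
  all_goals rw [cnt_image _ _ _ (fun _ _ h => by injection h)]
  all_goals assumption
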